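/- arXiv:2602.06756 — 10 statements merged into one kernel-verified Lean document; each statement's English description precedes it below -/
import Mathlib

section
/- Let (P₁, Q₁) be mutually absolutely continuous probability measures on a measurable space Ω₁ and let r = dQ₁/dP₁ denote the Radon–Nikodym derivative. Let {H_i}_{i∈I} be a nonempty family of privacy profiles that is totally ordered under the pointwise order (for any i, j ∈ I, either H_i(γ) ≤ H_j(γ) for all γ ≥ 0 or H_j(γ) ≤ H_i(γ) for all γ ≥ 0), and let H^↑(γ) = sup_{i∈I} H_i(γ). Let H_B : [0,∞) → [0,1] be an arbitrary function. If for every i ∈ I and every γ ≥ 0 one has ∫_{Ω₁} H_i(γ · r(y)) dP₁(y) ≤ H_B(γ), then for every γ ≥ 0, ∫_{Ω₁} H^↑(γ · r(y)) dP₁(y) ≤ H_B(γ). -/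
open MeasureTheory

/-- A privacy profile: a function `H : [0,∞) → [0,1]` (encoded on `ℝ`, with the
conditions imposed on `[0,∞)`) that is convex, nonincreasing, has `H 0 = 1` and
satisfies `max (1 - γ) 0 ≤ H γ ≤ 1` for all `γ ≥ 0`. -/
def IsPrivacyProfile (H : ℝ → ℝ) : Prop :=
  ConvexOn ℝ (Set.Ici 0) H ∧ AntitoneOn H (Set.Ici 0) ∧ H 0 = 1 ∧
    ∀ γ ≥ (0 : ℝ), max (1 - γ) 0 ≤ H γ ∧ H γ ≤ 1

open Filter Topology

lemma aux_rat {H : ℝ → ℝ} (h : IsPrivacyProfile H) {x c : ℝ} (hx : 0 ≤ x) (hc : c < H x) :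
    ∃ q : ℚ, x ≤ q ∧ c < H q := by
  rcases hx.eq_or_lt with rfl | hx
  · exact ⟨0, by simp, by simpa using hc⟩
  · have hcont : ContinuousAt H x := by
      have := h.1.continuousOn_interior
      rw [interior_Ici] at this
      exact this.continuousAt (Ioi_mem_nhds hx)
    have h1 : ∀ᶠ y in 𝓝 x, c < H y := hcont.eventually (lt_mem_nhds hc)
    obtain ⟨ε, hε, hb⟩ := Metric.eventually_nhds_iff.1 h1
    obtain ⟨q, hq1, hq2⟩ := exists_rat_btwn (show x < x + ε by linarith)
    refine ⟨q, hq1.le, hb ?_⟩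
    rw [Real.dist_eq, abs_lt]
    constructor <;> linarith

lemma aux_seq {I : Type*} [Nonempty I] (H : I → ℝ → ℝ)
    (hprof : ∀ i, IsPrivacyProfile (H i)) :
    ∃ e : ℕ → I, ∀ i, ∀ x ≥ (0 : ℝ), ∀ c < H i x, ∃ n, c < H (e n) x := by
  classical
  have hex : ∀ p : ℚ × ℚ, ∃ j : I, (∃ i, (p.2 : ℝ) < H i p.1) → (p.2 : ℝ) < H j p.1 := by
    intro p
    by_cases hp : ∃ i, (p.2 : ℝ) < H i p.1
    · obtain ⟨i, hi⟩ := hp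
      exact ⟨i, fun _ => hi⟩
    · exact ⟨Classical.arbitrary I, fun h => absurd h hp⟩
  choose f hf using hex
  obtain ⟨g, hg⟩ := exists_surjective_nat (ℚ × ℚ)
  refine ⟨fun n => f (g n), fun i x hx c hc => ?_⟩
  obtain ⟨c', h1, h2⟩ := exists_rat_btwn hc
  obtain ⟨q, hq, hq2⟩ := aux_rat (hprof i) hx h2
  obtain ⟨n, hn⟩ := hg (q, c')
  refine ⟨n, ?_⟩
  have h3 : (c' : ℝ) < H (f (q, c')) q := hf (q, c') ⟨i, hq2⟩
  have h4 := (hprof (f (q, c'))).2.1 (Set.mem_Ici.2 hx) (Set.mem_Ici.2 (le_trans hx hq)) hq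
  simp only [hn]
  linarith

lemma aux_mono {I : Type*} [Nonempty I] (H : I → ℝ → ℝ)
    (hprof : ∀ i, IsPrivacyProfile (H i))
    (hchain : ∀ i j, (∀ γ ≥ (0 : ℝ), H i γ ≤ H j γ) ∨ (∀ γ ≥ (0 : ℝ), H j γ ≤ H i γ)) :
    ∃ g : ℕ → I, ∀ x ≥ (0 : ℝ), Tendsto (fun n => H (g n) x) atTop (𝓝 (⨆ i, H i x)) := by
  obtain ⟨e, he⟩ := aux_seq H hprof
  have hm : ∀ i j, ∃ k, ∀ x ≥ (0 : ℝ), H i x ≤ H k x ∧ H j x ≤ H k x := by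
    intro i j
    rcases hchain i j with h | h
    · exact ⟨j, fun x hx => ⟨h x hx, le_rfl⟩⟩
    · exact ⟨i, fun x hx => ⟨le_rfl, h x hx⟩⟩
  choose m hm using hm
  let g : ℕ → I := fun n => Nat.rec (e 0) (fun k a => m a (e (k + 1))) n
  have hg : ∀ n, g (n + 1) = m (g n) (e (n + 1)) := fun n => rfl
  refine ⟨g, fun x hx => ?_⟩
  have hbdd : BddAbove (Set.range fun i => H i x) :=
    ⟨1, by rintro _ ⟨i, rfl⟩; exact ((hprof i).2.2.2 x hx).2⟩
  apply tendsto_atTop_isLUB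
  · refine monotone_nat_of_le_succ fun n => ?_
    rw [hg]
    exact (hm _ _ x hx).1
  · constructor
    · rintro _ ⟨n, rfl⟩
      exact le_ciSup hbdd (g n)
    · intro b hb
      refine ciSup_le fun i => le_of_forall_lt fun c hc => ?_
      obtain ⟨n, hn⟩ := he i x hx c hc
      have h1 : H (e n) x ≤ H (g n) x := by
        cases n with
        | zero => exact le_rfl
        | succ k => rw [hg]; exact (hm _ _ x hx).2
      exact (hn.trans_le h1).trans_le (hb ⟨n, rfl⟩)

/-- **Validity of the natural `f`-DP filter over a Blackwell chain (two-step case,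
privacy-profile form).**  If `(P₁, Q₁)` are mutually absolutely continuous probability
measures with `r = dQ₁/dP₁`, `{H i}_{i ∈ I}` is a nonempty, pointwise totally ordered
family of privacy profiles with pointwise supremum `H^↑`, and for every `i` and every
`γ ≥ 0` one has `∫ H_i(γ · r(y)) dP₁(y) ≤ H_B(γ)`, then also
`∫ H^↑(γ · r(y)) dP₁(y) ≤ H_B(γ)` for every `γ ≥ 0`. -/
theorem fDP_filter_validity_blackwell_chain
    {Ω₁ : Type*} [MeasurableSpace Ω₁]
    (P₁ Q₁ : Measure Ω₁) [IsProbabilityMeasure P₁] [IsProbabilityMeasure Q₁]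
    (hPQ : P₁ ≪ Q₁) (hQP : Q₁ ≪ P₁)
    {I : Type*} [Nonempty I] (H : I → ℝ → ℝ)
    (hprof : ∀ i, IsPrivacyProfile (H i))
    (hchain : ∀ i j, (∀ γ ≥ (0 : ℝ), H i γ ≤ H j γ) ∨ (∀ γ ≥ (0 : ℝ), H j γ ≤ H i γ))
    (HB : ℝ → ℝ)
    (hbound : ∀ i, ∀ γ ≥ (0 : ℝ),
      ∫ y, H i (γ * (Q₁.rnDeriv P₁ y).toReal) ∂P₁ ≤ HB γ) :
    ∀ γ ≥ (0 : ℝ),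
      ∫ y, (⨆ i, H i (γ * (Q₁.rnDeriv P₁ y).toReal)) ∂P₁ ≤ HB γ := by
  intro γ hγ
  obtain ⟨g, hg⟩ := aux_mono H hprof hchain
  have hnn : ∀ y, 0 ≤ γ * (Q₁.rnDeriv P₁ y).toReal := fun y =>
    mul_nonneg hγ ENNReal.toReal_nonneg
  have hlim : Tendsto (fun n => ∫ y, H (g n) (γ * (Q₁.rnDeriv P₁ y).toReal) ∂P₁) atTop
      (𝓝 (∫ y, (⨆ i, H i (γ * (Q₁.rnDeriv P₁ y).toReal)) ∂P₁)) := by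
    refine tendsto_integral_of_dominated_convergence (fun _ => (1 : ℝ)) (fun n => ?_)
      (integrable_const 1) (fun n => ?_) ?_
    · have ha : Antitone fun x : ℝ => H (g n) (max x 0) := fun a b hab =>
        (hprof (g n)).2.1 (Set.mem_Ici.2 (le_max_right _ _)) (Set.mem_Ici.2 (le_max_right _ _))
          (max_le_max hab le_rfl)
      have hmeas : Measurable fun y => γ * (Q₁.rnDeriv P₁ y).toReal :=
        (Measure.measurable_rnDeriv Q₁ P₁).ennreal_toReal.const_mul γ
      have h := ha.measurable.comp hmeas
      have heq : (fun y => H (g n) (γ * (Q₁.rnDeriv P₁ y).toReal)) =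
          (fun x : ℝ => H (g n) (max x 0)) ∘ fun y => γ * (Q₁.rnDeriv P₁ y).toReal := by
        funext y
        simp only [Function.comp_apply, max_eq_left (hnn y)]
      rw [heq]
      exact h.aestronglyMeasurable
    · refine Eventually.of_forall fun y => ?_
      have h := (hprof (g n)).2.2.2 _ (hnn y)
      rw [Real.norm_eq_abs, abs_of_nonneg ((le_max_right _ _).trans h.1)]
      exact h.2
    · exact Eventually.of_forall fun y => hg _ (hnn y)
  exact le_of_tendsto' hlim fun n => hbound (g n) γ hγ
end

section
/- Let H be a nonempty family of privacy profiles that is totally ordered under the pointwise order (for any H₁, H₂ ∈ H, either H₁(γ) ≤ H₂(γ) for all γ ≥ 0 or H₂(γ) ≤ H₁(γ) for all γ ≥ 0), and let H^↑(γ) = sup_{H∈H} H(γ). Then there exists a sequence (H_n)_{n∈ℕ} of elements of H such that H_n(γ) ≤ H_{n+1}(γ) for all n and all γ ≥ 0, and H_n(γ) → H^↑(γ) as n → ∞ for every γ ≥ 0. -/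
open Filter

/-- **Existence of a pointwise increasing sequence converging to the supremum of a
Blackwell chain of privacy profiles.** If `{H i}_{i ∈ I}` is a nonempty family of
privacy profiles totally ordered under the pointwise order on `[0,∞)`, then there is a
sequence `(H (φ n))` of members of the family, pointwise increasing on `[0,∞)`, which
converges pointwise on `[0,∞)` to `H^↑(γ) = ⨆ i, H i γ`. -/
theorem chain_has_increasing_sequence_tendsto_sup
    {I : Type*} [Nonempty I] (H : I → ℝ → ℝ)
    (hprof : ∀ i, IsPrivacyProfile (H i))
    (hchain : ∀ i j, (∀ γ ≥ (0 : ℝ), H i γ ≤ H j γ) ∨ (∀ γ ≥ (0 : ℝ), H j γ ≤ H i γ)) :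
    ∃ φ : ℕ → I,
      (∀ n, ∀ γ ≥ (0 : ℝ), H (φ n) γ ≤ H (φ (n + 1)) γ) ∧
      (∀ γ ≥ (0 : ℝ),
        Tendsto (fun n => H (φ n) γ) atTop (nhds (⨆ i, H i γ))) := by
  classical
  have hbdd : ∀ γ ≥ (0 : ℝ), BddAbove (Set.range fun i => H i γ) := by
    intro γ hγ
    refine ⟨1, ?_⟩
    rintro _ ⟨i, rfl⟩
    exact ((hprof i).2.2.2 γ hγ).2
  have hex : ∀ p : ℚ × ℕ, ∃ i, (⨆ j, H j (p.1 : ℝ)) - 1 / ((p.2 : ℝ) + 1) < H i (p.1 : ℝ) := by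
    intro p
    apply exists_lt_of_lt_ciSup
    have : (0 : ℝ) < 1 / ((p.2 : ℝ) + 1) := by positivity
    linarith
  choose g hg using hex
  obtain ⟨e, he⟩ := exists_surjective_nat (ℚ × ℕ)
  have hmax : ∀ i j, ∃ k, (∀ γ ≥ (0 : ℝ), H i γ ≤ H k γ) ∧ (∀ γ ≥ (0 : ℝ), H j γ ≤ H k γ) := by
    intro i j
    rcases hchain i j with h | h
    · exact ⟨j, h, fun _ _ => le_rfl⟩
    · exact ⟨i, fun _ _ => le_rfl, h⟩
  choose m hm1 hm2 using hmax
  let φ : ℕ → I := fun n => Nat.rec (g (e 0)) (fun n i => m i (g (e (n + 1)))) n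
  have hφ : ∀ n, φ (n + 1) = m (φ n) (g (e (n + 1))) := fun n => rfl
  have hmono : ∀ n, ∀ γ ≥ (0 : ℝ), H (φ n) γ ≤ H (φ (n + 1)) γ := by
    intro n γ hγ
    rw [hφ]
    exact hm1 _ _ γ hγ
  have hge : ∀ n, ∀ γ ≥ (0 : ℝ), H (g (e n)) γ ≤ H (φ n) γ := by
    intro n γ hγ
    cases n with
    | zero => exact le_rfl
    | succ n =>
      rw [hφ]
      exact hm2 _ _ γ hγ
  refine ⟨φ, hmono, ?_⟩
  intro γ hγ
  apply tendsto_atTop_isLUB (monotone_nat_of_le_succ fun n => hmono n γ hγ)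
  constructor
  · rintro _ ⟨n, rfl⟩
    exact le_ciSup (hbdd γ hγ) (φ n)
  · intro b hb
    have hb' : ∀ n, H (φ n) γ ≤ b := fun n => hb ⟨n, rfl⟩
    apply ciSup_le
    intro i
    rcases hγ.eq_or_lt with h0 | hpos
    · have h := hb' 0
      rw [← h0, (hprof _).2.2.1] at h
      rw [← h0, (hprof i).2.2.1]
      exact h
    by_contra! hlt
    have hcont : ContinuousAt (H i) γ := by
      have h1 := (hprof i).1.continuousOn_interior
      rw [interior_Ici] at h1
      exact h1.continuousAt (Ioi_mem_nhds hpos)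
    have hev : ∀ᶠ x in nhds γ, b < H i x := hcont.eventually (lt_mem_nhds hlt)
    obtain ⟨δ, hδ, hball⟩ := Metric.eventually_nhds_iff.1 hev
    obtain ⟨q, hq1, hq2⟩ := exists_rat_btwn (show γ < γ + δ by linarith)
    have hq0 : (0 : ℝ) ≤ q := by linarith
    have hbq : b < H i q := by
      apply hball
      rw [Real.dist_eq, abs_of_pos] <;> linarith
    obtain ⟨k, hk⟩ := exists_nat_one_div_lt (sub_pos.2 hbq)
    obtain ⟨n, hn⟩ := he (q, k)
    have h1 := hg (q, k)
    have h2 := le_ciSup (hbdd q hq0) i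
    have h3 := hge n γ hγ
    rw [hn] at h3
    have h4 : H (g (q, k)) q ≤ H (g (q, k)) γ := (hprof _).2.1 hγ hq0 hq1.le
    have h5 := hb' n
    simp only at h1 h2
    linarith
end

section
/- Let H be a nonempty family of privacy profiles that is totally ordered under the pointwise order, and let H^↑(γ) = sup_{H∈H} H(γ). Then there exists a sequence (H_n)_{n≥1} of elements of H that is increasing in the pointwise order (H_n(γ) ≤ H_{n+1}(γ) for all γ ≥ 0 and all n) such that for every n ≥ 1 and every integer i with 1 ≤ i ≤ n·2ⁿ, one has H^↑(i/2ⁿ) − 1/n < H_n(i/2ⁿ) ≤ H^↑(i/2ⁿ). -/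
/-- **Dyadic approximation of the supremum of a Blackwell chain of privacy profiles.**
If `{H i}_{i ∈ I}` is a nonempty family of privacy profiles totally ordered under the
pointwise order on `[0,∞)`, then there is a pointwise increasing sequence `(H (φ n))`
of members of the family such that for every `n ≥ 1` and every integer `1 ≤ i ≤ n·2ⁿ`,
`H^↑(i/2ⁿ) − 1/n < H (φ n) (i/2ⁿ) ≤ H^↑(i/2ⁿ)`, where `H^↑(γ) = ⨆ j, H j γ`. -/
theorem chain_dyadic_approximation_of_sup
    {I : Type*} [Nonempty I] (H : I → ℝ → ℝ)
    (hprof : ∀ i, IsPrivacyProfile (H i))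
    (hchain : ∀ i j, (∀ γ ≥ (0 : ℝ), H i γ ≤ H j γ) ∨ (∀ γ ≥ (0 : ℝ), H j γ ≤ H i γ)) :
    ∃ φ : ℕ → I,
      (∀ n, ∀ γ ≥ (0 : ℝ), H (φ n) γ ≤ H (φ (n + 1)) γ) ∧
      (∀ n : ℕ, 1 ≤ n → ∀ i : ℕ, 1 ≤ i → i ≤ n * 2 ^ n →
        (⨆ j, H j ((i : ℝ) / 2 ^ n)) - 1 / (n : ℝ) < H (φ n) ((i : ℝ) / 2 ^ n) ∧
        H (φ n) ((i : ℝ) / 2 ^ n) ≤ ⨆ j, H j ((i : ℝ) / 2 ^ n)) := by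
  have hbdd : ∀ γ ≥ (0 : ℝ), BddAbove (Set.range fun j => H j γ) := by
    intro γ hγ
    refine ⟨1, ?_⟩
    rintro _ ⟨j, rfl⟩
    exact ((hprof j).2.2.2 γ hγ).2
  have hdir : ∀ i j, ∃ k, (∀ γ ≥ (0 : ℝ), H i γ ≤ H k γ) ∧ (∀ γ ≥ (0 : ℝ), H j γ ≤ H k γ) := by
    intro i j
    rcases hchain i j with h | h
    · exact ⟨j, h, fun _ _ => le_rfl⟩
    · exact ⟨i, fun _ _ => le_rfl, h⟩
  have hg : ∀ n : ℕ, ∃ k, 1 ≤ n → ∀ i : ℕ, i ≤ n * 2 ^ n →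
      (⨆ j, H j ((i : ℝ) / 2 ^ n)) - 1 / (n : ℝ) < H k ((i : ℝ) / 2 ^ n) := by
    intro n
    rcases Nat.eq_zero_or_pos n with h0 | hn
    · exact ⟨Classical.arbitrary I, fun h => by omega⟩
    have hn' : (0 : ℝ) < 1 / (n : ℝ) := by positivity
    have one : ∀ i : ℕ, ∃ k, (⨆ j, H j ((i : ℝ) / 2 ^ n)) - 1 / (n : ℝ)
        < H k ((i : ℝ) / 2 ^ n) := fun i =>
      exists_lt_of_lt_ciSup (sub_lt_self _ hn')
    have key : ∀ N : ℕ, ∃ k, ∀ i : ℕ, i ≤ N →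
        (⨆ j, H j ((i : ℝ) / 2 ^ n)) - 1 / (n : ℝ) < H k ((i : ℝ) / 2 ^ n) := by
      intro N
      induction N with
      | zero =>
        obtain ⟨k, hk⟩ := one 0
        refine ⟨k, fun i hi => ?_⟩
        obtain rfl : i = 0 := by omega
        exact hk
      | succ N ih =>
        obtain ⟨k, hk⟩ := ih
        obtain ⟨l, hl⟩ := one (N + 1)
        obtain ⟨m, h1, h2⟩ := hdir k l
        refine ⟨m, fun i hi => ?_⟩
        rcases Nat.lt_or_ge N i with h | h
        · obtain rfl : i = N + 1 := by omega
          exact hl.trans_le (h2 _ (by positivity))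
        · exact (hk i h).trans_le (h1 _ (by positivity))
    obtain ⟨k, hk⟩ := key (n * 2 ^ n)
    exact ⟨k, fun _ => hk⟩
  choose g hg using hg
  choose u hu1 hu2 using hdir
  let φ : ℕ → I := fun n => Nat.rec (g 0) (fun m x => u x (g (m + 1))) n
  refine ⟨φ, fun n => hu1 (φ n) (g (n + 1)), ?_⟩
  intro n hn i _ hi
  refine ⟨?_, le_ciSup (hbdd _ (by positivity)) (φ n)⟩
  obtain ⟨m, rfl⟩ : ∃ m, n = m + 1 := ⟨n - 1, by omega⟩
  exact (hg (m + 1) hn i hi).trans_le (hu2 (φ m) (g (m + 1)) _ (by positivity))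
end

section
/- Let (H_n)_{n∈ℕ} be a sequence of privacy profiles and let H be a privacy profile. The following are equivalent: (i) sup_{γ≥0} |H_n(γ) − H(γ)|/(1+γ) → 0 as n → ∞ (convergence in the symmetrised Δ-divergence); (ii) H_n(γ) → H(γ) as n → ∞ for every γ ≥ 0 (pointwise convergence); (iii) for every γ_max > 0, sup_{γ∈[0,γ_max]} |H_n(γ) − H(γ)| → 0 as n → ∞ (uniform convergence on every compact set). -/
open Filter

theorem pp_lip {H : ℝ → ℝ} (h : IsPrivacyProfile H) {x y : ℝ} (hx : 0 ≤ x) (hxy : x ≤ y) :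
    |H x - H y| ≤ y - x := by
  obtain ⟨hc, ha, h0, hb⟩ := h
  have hy : 0 ≤ y := hx.trans hxy
  have h1 : H y ≤ H x := ha hx hy hxy
  rw [abs_of_nonneg (by linarith)]
  rcases hxy.eq_or_lt with rfl | hlt
  · simp
  rcases hx.eq_or_lt with rfl | hx0
  · have := (le_max_left _ _).trans (hb y hy).1
    linarith
  have hs := hc.slope_mono_adjacent (x := 0) (y := x) (z := y) Set.self_mem_Ici hy hx0 hlt
  have h2 := (le_max_left _ _).trans (hb x hx).1
  have h3 : (-1 : ℝ) ≤ (H x - H 0) / (x - 0) := by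
    rw [le_div_iff₀ (by linarith)]
    linarith
  have h4 := h3.trans hs
  rw [le_div_iff₀ (by linarith)] at h4
  linarith

theorem pp_diff {H G : ℝ → ℝ} (h : IsPrivacyProfile H) (g : IsPrivacyProfile G) {x : ℝ}
    (hx : 0 ≤ x) : |H x - G x| ≤ 1 := by
  have h1 := h.2.2.2 x hx
  have h2 := g.2.2.2 x hx
  have h3 := (le_max_right _ _).trans h1.1
  have h4 := (le_max_right _ _).trans h2.1
  rw [abs_le]
  constructor <;> linarith

theorem pp_unif (Hn : ℕ → ℝ → ℝ) (H : ℝ → ℝ)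
    (hprofn : ∀ n, IsPrivacyProfile (Hn n)) (hprof : IsPrivacyProfile H)
    (hp : ∀ γ ≥ (0 : ℝ), Tendsto (fun n => Hn n γ) atTop (nhds (H γ)))
    (M ε : ℝ) (hε : 0 < ε) :
    ∀ᶠ n in atTop, ∀ γ, 0 ≤ γ → γ ≤ M → |Hn n γ - H γ| ≤ ε := by
  have hd : 0 < ε / 3 := by positivity
  have hev : ∀ᶠ n in atTop, ∀ k ∈ Finset.range (⌊M / (ε / 3)⌋₊ + 1),
      |Hn n (k * (ε / 3)) - H (k * (ε / 3))| < ε / 3 := by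
    rw [Filter.eventually_all_finset]
    intro k _
    have := (Metric.tendsto_nhds.1 (hp (k * (ε / 3)) (by positivity))) (ε / 3) hd
    simpa [Real.dist_eq] using this
  filter_upwards [hev] with n hn γ h0 hM
  have hq : 0 ≤ γ / (ε / 3) := by positivity
  have h1 := Nat.floor_le hq
  have h2 := (Nat.lt_floor_add_one (γ / (ε / 3))).le
  have hk := hn ⌊γ / (ε / 3)⌋₊ (by
    rw [Finset.mem_range, Nat.lt_succ_iff]
    apply Nat.floor_mono
    gcongr)
  rw [le_div_iff₀ hd] at h1
  rw [div_le_iff₀ hd] at h2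
  have ht : 0 ≤ (⌊γ / (ε / 3)⌋₊ : ℝ) * (ε / 3) := by positivity
  have l1 := pp_lip (hprofn n) ht h1
  have l2 := pp_lip hprof ht h1
  rw [abs_le] at l1 l2 ⊢
  rw [abs_lt] at hk
  constructor <;> linarith

theorem pp_sup {ι : Type*} [Nonempty ι] (f : ℕ → ι → ℝ) (h0 : ∀ n i, 0 ≤ f n i)
    (h : ∀ ε > 0, ∀ᶠ n in atTop, ∀ i, f n i ≤ ε) :
    Tendsto (fun n => ⨆ i, f n i) atTop (nhds 0) := by
  rw [Metric.tendsto_nhds]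
  intro ε hε
  filter_upwards [h (ε / 2) (by positivity)] with n hn
  have h1 : ⨆ i, f n i ≤ ε / 2 := ciSup_le hn
  have h2 : 0 ≤ ⨆ i, f n i := Real.iSup_nonneg (h0 n)
  rw [Real.dist_eq, sub_zero, abs_of_nonneg h2]
  linarith

/-- **Equivalent notions of convergence for privacy profiles.** For a sequence of
privacy profiles `Hn` and a privacy profile `H`, the following are equivalent:
(i) convergence in the symmetrised Δ-divergence, i.e.
`sup_{γ ≥ 0} |Hn(γ) − H(γ)|/(1+γ) → 0`;
(ii) pointwise convergence on `[0,∞)`;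
(iii) uniform convergence on every compact interval `[0, γmax]`. -/
theorem privacyProfile_convergence_tfae
    (Hn : ℕ → ℝ → ℝ) (H : ℝ → ℝ)
    (hprofn : ∀ n, IsPrivacyProfile (Hn n)) (hprof : IsPrivacyProfile H) :
    ((Tendsto (fun n => ⨆ γ : Set.Ici (0 : ℝ), |Hn n γ - H γ| / (1 + (γ : ℝ)))
        atTop (nhds 0)) ↔
      (∀ γ ≥ (0 : ℝ), Tendsto (fun n => Hn n γ) atTop (nhds (H γ)))) ∧
    ((∀ γ ≥ (0 : ℝ), Tendsto (fun n => Hn n γ) atTop (nhds (H γ))) ↔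
      (∀ γmax > (0 : ℝ),
        Tendsto (fun n => ⨆ γ : Set.Icc (0 : ℝ) γmax, |Hn n γ - H γ|)
          atTop (nhds 0))) := by
  refine ⟨⟨fun h γ hγ => ?_, fun hp => ?_⟩, ⟨fun hp M hM => ?_, fun h γ hγ => ?_⟩⟩
  · rw [tendsto_iff_norm_sub_tendsto_zero]
    have h' := h.mul_const (1 + γ)
    rw [zero_mul] at h'
    refine squeeze_zero (fun n => norm_nonneg _) (fun n => ?_) h'
    rw [← div_le_iff₀ (by linarith), Real.norm_eq_abs]
    refine le_ciSup (f := fun γ : Set.Ici (0 : ℝ) => |Hn n γ - H γ| / (1 + (γ : ℝ)))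
      ⟨1, ?_⟩ ⟨γ, hγ⟩
    rintro _ ⟨⟨x, hx⟩, rfl⟩
    have hx' : 0 ≤ x := hx
    have := pp_diff (hprofn n) hprof hx'
    show |Hn n x - H x| / (1 + x) ≤ 1
    rw [div_le_iff₀ (by linarith)]
    linarith
  · refine pp_sup (fun n (γ : Set.Ici (0 : ℝ)) => |Hn n γ - H γ| / (1 + (γ : ℝ))) ?_ ?_
    · rintro n ⟨x, hx⟩
      have hx' : 0 ≤ x := hx
      show 0 ≤ |Hn n x - H x| / (1 + x)
      positivity
    · intro ε hε
      filter_upwards [pp_unif Hn H hprofn hprof hp (1 / ε) ε hε] with n hn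
      rintro ⟨x, hx⟩
      have hx' : 0 ≤ x := hx
      show |Hn n x - H x| / (1 + x) ≤ ε
      rw [div_le_iff₀ (by linarith)]
      rcases le_total x (1 / ε) with hxe | hxe
      · nlinarith [hn x hx' hxe]
      · rw [div_le_iff₀ hε] at hxe
        nlinarith [pp_diff (hprofn n) hprof hx']
  · haveI : Nonempty (Set.Icc (0 : ℝ) M) := ⟨⟨0, le_rfl, hM.le⟩⟩
    refine pp_sup (fun n (γ : Set.Icc (0 : ℝ) M) => |Hn n γ - H γ|)
      (fun n i => abs_nonneg _) ?_
    intro ε hε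
    filter_upwards [pp_unif Hn H hprofn hprof hp M ε hε] with n hn
    rintro ⟨x, hx⟩
    exact hn x hx.1 hx.2
  · rw [tendsto_iff_norm_sub_tendsto_zero]
    refine squeeze_zero (fun n => norm_nonneg _) (fun n => ?_) (h (γ + 1) (by linarith))
    rw [Real.norm_eq_abs]
    refine le_ciSup (f := fun x : Set.Icc (0 : ℝ) (γ + 1) => |Hn n x - H x|)
      ⟨1, ?_⟩ ⟨γ, hγ, by linarith⟩
    rintro _ ⟨⟨x, hx⟩, rfl⟩
    exact pp_diff (hprofn n) hprof hx.1
end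

section
/- Let (f_n)_{n∈ℕ} be a sequence of trade-off functions and let f be a trade-off function. The following are equivalent: (i) there exists a sequence Δ_n ≥ 0 with Δ_n → 0 such that for every n and every α ∈ [0, 1 − Δ_n], both f_n(α + Δ_n) − Δ_n ≤ f(α) and f(α + Δ_n) − Δ_n ≤ f_n(α) hold (convergence in Δ-divergence); (ii) f_n(α) → f(α) as n → ∞ for every α ∈ (0,1]; (iii) for every α_min ∈ (0,1], sup_{α∈[α_min,1]} |f_n(α) − f(α)| → 0 as n → ∞. -/
open Filter

/-- A trade-off function: a function `f : [0,1] → [0,1]` (encoded on `ℝ`, with the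
conditions imposed on `[0,1]`) that is convex, nonincreasing, continuous, and satisfies
`0 ≤ f α ≤ 1 − α` for all `α ∈ [0,1]`. -/
def IsTradeOffFun (f : ℝ → ℝ) : Prop :=
  ConvexOn ℝ (Set.Icc 0 1) f ∧ AntitoneOn f (Set.Icc 0 1) ∧
    ContinuousOn f (Set.Icc 0 1) ∧
    ∀ α ∈ Set.Icc (0 : ℝ) 1, 0 ≤ f α ∧ f α ≤ 1 - α

theorem unif_aux (fn : ℕ → ℝ → ℝ) (f : ℝ → ℝ)
    (hfn : ∀ n, IsTradeOffFun (fn n)) (hf : IsTradeOffFun f)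
    (h : ∀ α ∈ Set.Ioc (0 : ℝ) 1, Tendsto (fun n => fn n α) atTop (nhds (f α)))
    (a : ℝ) (ha : a ∈ Set.Ioc (0 : ℝ) 1) (ε : ℝ) (hε : 0 < ε) :
    ∀ᶠ n in atTop, ∀ α ∈ Set.Icc a 1, |fn n α - f α| ≤ ε := by
  obtain ⟨_, hmono, hcont, hb⟩ := hf
  obtain ⟨ha0, ha1⟩ := ha
  refine (isCompact_Icc : IsCompact (Set.Icc a 1)).induction_on
    (p := fun s => ∀ᶠ n in atTop, ∀ α ∈ s, |fn n α - f α| ≤ ε) ?_ ?_ ?_ ?_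
  · simp
  · intro s t hst ht
    filter_upwards [ht] with n hn α hα using hn α (hst hα)
  · intro s t hs ht
    filter_upwards [hs, ht] with n h1 h2 α hα
    exact hα.elim (h1 α) (h2 α)
  · intro x hx
    obtain ⟨hx0, hx1⟩ := hx
    obtain ⟨d, hd, hdx⟩ := Metric.continuousOn_iff.1 hcont x ⟨by linarith, hx1⟩ (ε / 4) (by linarith)
    set e := min (d / 2) (a / 2) with he
    have he0 : 0 < e := lt_min (by linarith) (by linarith)
    have hed : e ≤ d / 2 := min_le_left _ _
    have hea : e ≤ a / 2 := min_le_right _ _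
    set z := min (x + e) 1 with hz
    have hz1 : z ≤ 1 := min_le_right _ _
    have hze : z ≤ x + e := min_le_left _ _
    have hxz : x ≤ z := le_min (by linarith) hx1
    have hy := hdx (x - e) ⟨by linarith, by linarith⟩
      (by rw [Real.dist_eq, abs_lt]; constructor <;> linarith)
    have hzz := hdx z ⟨by linarith, by linarith⟩
      (by rw [Real.dist_eq, abs_lt]; constructor <;> linarith)
    rw [Real.dist_eq, abs_lt] at hy hzz
    refine ⟨Set.Icc a 1 ∩ Set.Icc (x - e) (x + e), ?_, ?_⟩
    · exact inter_mem_nhdsWithin _ (Icc_mem_nhds (by linarith) (by linarith))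
    · have t1 := Metric.tendsto_nhds.1 (h (x - e) ⟨by linarith, by linarith⟩) (ε / 4) (by linarith)
      have t2 := Metric.tendsto_nhds.1 (h z ⟨by linarith, by linarith⟩) (ε / 4) (by linarith)
      filter_upwards [t1, t2] with n h1 h2 α hα
      obtain ⟨⟨hα1, hα2⟩, hα3, hα4⟩ := hα
      rw [Real.dist_eq, abs_lt] at h1 h2
      have hαz : α ≤ z := le_min hα4 hα2
      have my : x - e ∈ Set.Icc (0 : ℝ) 1 := ⟨by linarith, by linarith⟩
      have mz : z ∈ Set.Icc (0 : ℝ) 1 := ⟨by linarith, by linarith⟩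
      have mα : α ∈ Set.Icc (0 : ℝ) 1 := ⟨by linarith, by linarith⟩
      have k1 := hmono my mα hα3
      have k2 := hmono mα mz hαz
      have k3 := (hfn n).2.1 my mα hα3
      have k4 := (hfn n).2.1 mα mz hαz
      rw [abs_le]
      constructor <;> linarith

/-- **Equivalent notions of convergence for trade-off functions.** For a sequence of
trade-off functions `fn` and a trade-off function `f`, the following are equivalent:
(i) convergence in Δ-divergence: there are `Δ n ≥ 0` with `Δ n → 0` such that for all
`n` and all `α ∈ [0, 1 − Δ n]`, `fn n (α + Δ n) − Δ n ≤ f α` and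
`f (α + Δ n) − Δ n ≤ fn n α`;
(ii) pointwise convergence on `(0,1]`;
(iii) uniform convergence on `[αmin, 1]` for every `αmin ∈ (0,1]`. -/
theorem tradeOffFun_convergence_tfae
    (fn : ℕ → ℝ → ℝ) (f : ℝ → ℝ)
    (hfn : ∀ n, IsTradeOffFun (fn n)) (hf : IsTradeOffFun f) :
    ((∃ Δ : ℕ → ℝ, (∀ n, 0 ≤ Δ n) ∧ Tendsto Δ atTop (nhds 0) ∧
        ∀ n, ∀ α ∈ Set.Icc (0 : ℝ) (1 - Δ n),
          fn n (α + Δ n) - Δ n ≤ f α ∧ f (α + Δ n) - Δ n ≤ fn n α) ↔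
      (∀ α ∈ Set.Ioc (0 : ℝ) 1, Tendsto (fun n => fn n α) atTop (nhds (f α)))) ∧
    ((∀ α ∈ Set.Ioc (0 : ℝ) 1, Tendsto (fun n => fn n α) atTop (nhds (f α))) ↔
      (∀ αmin ∈ Set.Ioc (0 : ℝ) 1,
        Tendsto (fun n => ⨆ α : Set.Icc αmin 1, |fn n α - f α|)
          atTop (nhds 0))) := by
  have hU := unif_aux fn f hfn hf
  refine ⟨⟨?_, ?_⟩, ⟨?_, ?_⟩⟩
  · rintro ⟨Δ, hΔ0, hΔ, H⟩ α ⟨hα0, hα1⟩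
    rcases hα1.eq_or_lt with rfl | hα1
    · have e1 : f 1 = 0 := by
        have := hf.2.2.2 1 (by simp)
        linarith
      have e2 : ∀ n, fn n 1 = 0 := fun n => by
        have := (hfn n).2.2.2 1 (by simp)
        linarith
      simp [e1, e2]
    · have hc : ContinuousAt f α := hf.2.2.1.continuousAt (Icc_mem_nhds hα0 hα1)
      have l1 : Tendsto (fun n => α + Δ n) atTop (nhds α) := by
        simpa using hΔ.const_add α
      have l2 : Tendsto (fun n => α - Δ n) atTop (nhds α) := by
        simpa using hΔ.const_sub α
      have m1 : Tendsto (fun n => f (α + Δ n) - Δ n) atTop (nhds (f α)) := by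
        simpa using (hc.tendsto.comp l1).sub hΔ
      have m2 : Tendsto (fun n => f (α - Δ n) + Δ n) atTop (nhds (f α)) := by
        simpa using (hc.tendsto.comp l2).add hΔ
      refine tendsto_of_tendsto_of_tendsto_of_le_of_le' m1 m2 ?_ ?_
      · filter_upwards [l1.eventually_lt_const hα1] with n hn
        exact (H n α ⟨hα0.le, by linarith⟩).2
      · filter_upwards [l2.eventually_const_lt hα0] with n hn
        have := (H n (α - Δ n) ⟨hn.le, by linarith⟩).1
        rw [sub_add_cancel] at this
        linarith
  · intro h
    let S : ℕ → Set ℝ := fun n => {D | 0 ≤ D ∧ ∀ α ∈ Set.Icc (0 : ℝ) (1 - D),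
          fn n (α + D) - D ≤ f α ∧ f (α + D) - D ≤ fn n α}
    have hS : ∀ n, (S n).Nonempty := by
      intro n
      refine ⟨1, zero_le_one, ?_⟩
      rintro α ⟨h0, h1⟩
      have : α = 0 := by linarith
      subst this
      have a1 := (hfn n).2.2.2 1 (by simp)
      have a2 := (hfn n).2.2.2 0 (by simp)
      have a3 := hf.2.2.2 1 (by simp)
      have a4 := hf.2.2.2 0 (by simp)
      rw [zero_add]
      constructor <;> linarith
    have hbd : ∀ n, BddBelow (S n) := fun n => ⟨0, fun D hD => hD.1⟩
    have hex : ∀ n : ℕ, ∃ D ∈ S n, D < sInf (S n) + 1 / ((n : ℝ) + 1) := fun n =>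
      exists_lt_of_csInf_lt (hS n) (by have : 0 < 1 / ((n : ℝ) + 1) := by positivity
                                       linarith)
    choose Δ hΔS hΔ using hex
    refine ⟨Δ, fun n => (hΔS n).1, ?_, fun n => (hΔS n).2⟩
    rw [Metric.tendsto_nhds]
    intro ε hε
    set δ := min (ε / 2) 1 with hδ
    have hδ0 : 0 < δ := lt_min (by linarith) one_pos
    have hδε : δ ≤ ε / 2 := min_le_left _ _
    have hδ1 : δ ≤ 1 := min_le_right _ _
    have t := (tendsto_one_div_add_atTop_nhds_zero_nat (𝕜 := ℝ)).eventually_lt_const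
      (show (0 : ℝ) < ε / 2 by linarith)
    filter_upwards [hU h δ ⟨hδ0, hδ1⟩ δ hδ0, t] with n hn htn
    have hmem : δ ∈ S n := by
      refine ⟨hδ0.le, ?_⟩
      rintro α ⟨h0, h1⟩
      have b := abs_le.1 (hn (α + δ) ⟨by linarith, by linarith⟩)
      have m1 : α ∈ Set.Icc (0 : ℝ) 1 := ⟨h0, by linarith⟩
      have m2 : α + δ ∈ Set.Icc (0 : ℝ) 1 := ⟨by linarith, by linarith⟩
      have c1 := hf.2.1 m1 m2 (by linarith)
      have c2 := (hfn n).2.1 m1 m2 (by linarith)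
      constructor <;> linarith
    have := csInf_le (hbd n) hmem
    have h3 := hΔ n
    have h4 := (hΔS n).1
    rw [Real.dist_eq, sub_zero, abs_of_nonneg h4]
    linarith
  · intro h a ha
    rw [Metric.tendsto_nhds]
    intro ε hε
    filter_upwards [hU h a ha (ε / 2) (by linarith)] with n hn
    have h0 : 0 ≤ ⨆ α : Set.Icc a 1, |fn n α - f α| := Real.iSup_nonneg fun _ => abs_nonneg _
    have h1 : ⨆ α : Set.Icc a 1, |fn n α - f α| ≤ ε / 2 :=
      Real.iSup_le (fun α => hn α α.2) (by linarith)
    rw [Real.dist_eq, sub_zero, abs_of_nonneg h0]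
    linarith
  · intro h α hα
    rw [tendsto_iff_dist_tendsto_zero]
    refine squeeze_zero (fun _ => dist_nonneg) (fun n => ?_) (h α hα)
    rw [Real.dist_eq]
    have hb : BddAbove (Set.range fun x : Set.Icc α 1 => |fn n x - f x|) := by
      refine ⟨1, ?_⟩
      rintro _ ⟨⟨x, hx1, hx2⟩, rfl⟩
      have m : x ∈ Set.Icc (0 : ℝ) 1 := ⟨hα.1.le.trans hx1, hx2⟩
      have a1 := (hfn n).2.2.2 x m
      have a2 := hf.2.2.2 x m
      have := m.1
      show |fn n x - f x| ≤ 1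
      rw [abs_le]
      constructor <;> linarith
    exact le_ciSup hb ⟨α, le_rfl, hα.2⟩
end

section
/- Let P₁, Q₁ be mutually absolutely continuous probability measures on a measurable space Ω₁ with Radon–Nikodym derivative r = dQ₁/dP₁, and let P₂, Q₂ be probability measures on a measurable space Ω₂. Then for every γ ≥ 0, the hockey-stick divergence of the product measures satisfies D_γ(P₁ × P₂ ‖ Q₁ × Q₂) = ∫_{Ω₁} D_{γ·r(y)}(P₂ ‖ Q₂) dP₁(y). -/
open MeasureTheory

/-- The hockey-stick divergence of order `γ ≥ 0` of `P` from `Q`, computed with the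
dominating measure `P + Q`:  `D_γ(P‖Q) = ∫ max(p − γ·q, 0) d(P+Q)` where `p, q` are the
densities of `P, Q` w.r.t. `P + Q`. (The value does not depend on the choice of
dominating measure.) -/
noncomputable def hockeyStick {Ω : Type*} [MeasurableSpace Ω] (γ : ℝ)
    (P Q : Measure Ω) : ℝ :=
  ∫ y, max ((P.rnDeriv (P + Q) y).toReal - γ * (Q.rnDeriv (P + Q) y).toReal) 0 ∂(P + Q)

theorem hockeyStick_eq_aux {Ω : Type*} [MeasurableSpace Ω] (γ : ℝ)
    (P Q μ : Measure Ω) [IsFiniteMeasure P] [IsFiniteMeasure Q] [SigmaFinite μ]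
    (f g : Ω → ENNReal) (hf : Measurable f) (hg : Measurable g)
    (hP : P = μ.withDensity f) (hQ : Q = μ.withDensity g) :
    hockeyStick γ P Q = ∫ y, max ((f y).toReal - γ * (g y).toReal) 0 ∂μ := by
  have hPm : P ≪ μ := hP ▸ withDensity_absolutelyContinuous μ f
  have hQm : Q ≪ μ := hQ ▸ withDensity_absolutelyContinuous μ g
  have hS : P + Q ≪ μ := by
    intro s hs
    simp [hPm hs, hQm hs]
  have hPS : P ≪ P + Q := Measure.absolutelyContinuous_of_le (Measure.le_add_right le_rfl)
  have hQS : Q ≪ P + Q := Measure.absolutelyContinuous_of_le (Measure.le_add_left le_rfl)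
  have h1 : P.rnDeriv μ =ᵐ[μ] f := by
    rw [hP]; exact Measure.rnDeriv_withDensity μ hf
  have h2 : Q.rnDeriv μ =ᵐ[μ] g := by
    rw [hQ]; exact Measure.rnDeriv_withDensity μ hg
  unfold hockeyStick
  rw [← integral_rnDeriv_smul hS]
  apply integral_congr_ae
  filter_upwards [h1, h2, Measure.rnDeriv_mul_rnDeriv (κ := μ) hPS,
    Measure.rnDeriv_mul_rnDeriv (κ := μ) hQS] with y a b c d
  rw [← a, ← b, ← c, ← d]
  simp only [Pi.mul_apply, ENNReal.toReal_mul, smul_eq_mul]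
  rw [mul_max_of_nonneg _ _ ENNReal.toReal_nonneg]
  congr 1 <;> ring

/-- **Tensor-product formula for the hockey-stick divergence.** If `P₁, Q₁` are
mutually absolutely continuous probability measures with `r = dQ₁/dP₁`, and `P₂, Q₂`
are probability measures, then for all `γ ≥ 0`,
`D_γ(P₁ × P₂ ‖ Q₁ × Q₂) = ∫ D_{γ·r(y)}(P₂ ‖ Q₂) dP₁(y)`. -/
theorem hockeyStick_prod_eq_integral
    {Ω₁ Ω₂ : Type*} [MeasurableSpace Ω₁] [MeasurableSpace Ω₂]
    (P₁ Q₁ : Measure Ω₁) [IsProbabilityMeasure P₁] [IsProbabilityMeasure Q₁]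
    (P₂ Q₂ : Measure Ω₂) [IsProbabilityMeasure P₂] [IsProbabilityMeasure Q₂]
    (hPQ : P₁ ≪ Q₁) (hQP : Q₁ ≪ P₁)
    (γ : ℝ) (hγ : 0 ≤ γ) :
    hockeyStick γ (P₁.prod P₂) (Q₁.prod Q₂)
      = ∫ y, hockeyStick (γ * (Q₁.rnDeriv P₁ y).toReal) P₂ Q₂ ∂P₁ := by
  have hPS : P₂ ≪ P₂ + Q₂ := Measure.absolutelyContinuous_of_le (Measure.le_add_right le_rfl)
  have hQS : Q₂ ≪ P₂ + Q₂ := Measure.absolutelyContinuous_of_le (Measure.le_add_left le_rfl)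
  have mp : Measurable (P₂.rnDeriv (P₂ + Q₂)) := Measure.measurable_rnDeriv _ _
  have mq : Measurable (Q₂.rnDeriv (P₂ + Q₂)) := Measure.measurable_rnDeriv _ _
  have mr : Measurable (Q₁.rnDeriv P₁) := Measure.measurable_rnDeriv _ _
  have e1 : P₁.prod P₂ = (P₁.prod (P₂ + Q₂)).withDensity
      (fun z => P₂.rnDeriv (P₂ + Q₂) z.2) := by
    have := prod_withDensity_right (μ := P₁) (ν := P₂ + Q₂) mp
    rwa [Measure.withDensity_rnDeriv_eq _ _ hPS] at this
  have e2 : Q₁.prod Q₂ = (P₁.prod (P₂ + Q₂)).withDensity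
      (fun z => Q₁.rnDeriv P₁ z.1 * Q₂.rnDeriv (P₂ + Q₂) z.2) := by
    have := prod_withDensity (μ := P₁) (ν := P₂ + Q₂) mr mq
    rwa [Measure.withDensity_rnDeriv_eq _ _ hQS, Measure.withDensity_rnDeriv_eq _ _ hQP] at this
  have mg : Measurable (fun z : Ω₁ × Ω₂ => Q₁.rnDeriv P₁ z.1 * Q₂.rnDeriv (P₂ + Q₂) z.2) := by
    fun_prop
  rw [hockeyStick_eq_aux γ _ _ (P₁.prod (P₂ + Q₂)) _ _ (mp.comp measurable_snd) mg e1 e2]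
  rw [integral_prod]
  · refine integral_congr_ae (Filter.Eventually.of_forall fun y => ?_)
    simp only [hockeyStick, Function.comp, ENNReal.toReal_mul, mul_assoc]
  · have i1 : Integrable (fun z : Ω₁ × Ω₂ => (P₂.rnDeriv (P₂ + Q₂) z.2).toReal)
        (P₁.prod (P₂ + Q₂)) :=
      (Measure.integrable_toReal_rnDeriv (μ := P₂) (ν := P₂ + Q₂)).comp_snd P₁
    refine i1.mono' (by fun_prop) (Filter.Eventually.of_forall fun z => ?_)
    rw [Real.norm_of_nonneg (le_max_right _ _)]
    refine max_le (sub_le_self _ (mul_nonneg hγ ENNReal.toReal_nonneg)) ENNReal.toReal_nonneg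
end

section
/- Let P₁, Q₁ be mutually absolutely continuous probability measures on a measurable space Ω₁. Let (P₂, Q₂) and (P₂′, Q₂′) be pairs of mutually absolutely continuous probability measures on measurable spaces Ω₂ and Ω₂′ respectively. If D_γ(P₂ ‖ Q₂) ≤ D_γ(P₂′ ‖ Q₂′) for all γ ≥ 0, then D_γ(P₁ × P₂ ‖ Q₁ × Q₂) ≤ D_γ(P₁ × P₂′ ‖ Q₁ × Q₂′) for all γ ≥ 0. (In particular, the tensor product of privacy profiles is well defined and monotone with respect to the Blackwell order.) -/
open MeasureTheory

theorem hs_eq {Ω : Type*} [MeasurableSpace Ω] (γ : ℝ)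
    (P Q : Measure Ω) [IsProbabilityMeasure P] [IsProbabilityMeasure Q] (h : P ≪ Q) :
    hockeyStick γ P Q = ∫ y, max ((P.rnDeriv Q y).toReal - γ) 0 ∂Q := by
  have hQ : Q ≪ P + Q := by
    rw [add_comm]; exact Measure.AbsolutelyContinuous.rfl.add_right P
  unfold hockeyStick
  rw [← integral_rnDeriv_smul hQ]
  refine integral_congr_ae ?_
  filter_upwards [Measure.rnDeriv_mul_rnDeriv (κ := P + Q) h] with y hy
  rw [← hy, Pi.mul_apply, ENNReal.toReal_mul, smul_eq_mul, mul_max_of_nonneg _ _ ENNReal.toReal_nonneg]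
  congr 1
  · ring
  · simp

theorem hs_prod {Ω₁ Ω₂ : Type*} [MeasurableSpace Ω₁] [MeasurableSpace Ω₂] (γ : ℝ) (hγ : 0 ≤ γ)
    (P₁ Q₁ : Measure Ω₁) [IsProbabilityMeasure P₁] [IsProbabilityMeasure Q₁]
    (P₂ Q₂ : Measure Ω₂) [IsProbabilityMeasure P₂] [IsProbabilityMeasure Q₂]
    (h₁ : P₁ ≪ Q₁) (h₂ : P₂ ≪ Q₂) :
    let F := fun x : Ω₁ => (P₁.rnDeriv Q₁ x).toReal *
        hockeyStick (γ / (P₁.rnDeriv Q₁ x).toReal) P₂ Q₂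
    Integrable F Q₁ ∧ hockeyStick γ (P₁.prod P₂) (Q₁.prod Q₂) = ∫ x, F x ∂Q₁ := by
  intro F
  have hr : (P₁.prod P₂).rnDeriv (Q₁.prod Q₂) =ᵐ[Q₁.prod Q₂]
      fun z => P₁.rnDeriv Q₁ z.1 * P₂.rnDeriv Q₂ z.2 := by
    have e : P₁.prod P₂ = (Q₁.prod Q₂).withDensity
        (fun z => P₁.rnDeriv Q₁ z.1 * P₂.rnDeriv Q₂ z.2) := by
      rw [← prod_withDensity (Measure.measurable_rnDeriv _ _) (Measure.measurable_rnDeriv _ _),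
        Measure.withDensity_rnDeriv_eq _ _ h₁, Measure.withDensity_rnDeriv_eq _ _ h₂]
    nth_rw 1 [e]
    exact Measure.rnDeriv_withDensity _ (by fun_prop)
  have hi : Integrable (fun z => max (((P₁.prod P₂).rnDeriv (Q₁.prod Q₂) z).toReal - γ) 0)
      (Q₁.prod Q₂) :=
    (Measure.integrable_toReal_rnDeriv.sub (integrable_const γ)).sup (integrable_zero _ _ _)
  have hc : (fun z => max (((P₁.prod P₂).rnDeriv (Q₁.prod Q₂) z).toReal - γ) 0)
      =ᵐ[Q₁.prod Q₂] fun z =>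
        max ((P₁.rnDeriv Q₁ z.1).toReal * (P₂.rnDeriv Q₂ z.2).toReal - γ) 0 := by
    filter_upwards [hr] with z hz
    rw [hz, ENNReal.toReal_mul]
  have hi' := hi.congr hc
  have hF : ∀ x, ∫ y, max ((P₁.rnDeriv Q₁ x).toReal * (P₂.rnDeriv Q₂ y).toReal - γ) 0 ∂Q₂
      = F x := by
    intro x
    simp only [F]
    rcases (ENNReal.toReal_nonneg (a := P₁.rnDeriv Q₁ x)).eq_or_lt with h0 | h0
    · simp [← h0, hγ]
    · rw [hs_eq _ _ _ h₂, ← integral_const_mul]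
      refine integral_congr_ae (Filter.Eventually.of_forall fun y => ?_)
      simp only
      rw [mul_max_of_nonneg _ _ h0.le, mul_sub, mul_div_cancel₀ _ h0.ne', mul_zero]
  refine ⟨hi'.integral_prod_left.congr (Filter.Eventually.of_forall hF), ?_⟩
  rw [hs_eq _ _ _ (h₁.prod h₂), integral_congr_ae hc, integral_prod _ hi']
  exact integral_congr_ae (Filter.Eventually.of_forall hF)

/-- **Monotonicity of the tensor product of privacy profiles w.r.t. the Blackwell
order.** If `(P₂, Q₂)` and `(P₂′, Q₂′)` are pairs of mutually absolutely continuous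
probability measures with `D_γ(P₂‖Q₂) ≤ D_γ(P₂′‖Q₂′)` for all `γ ≥ 0`, then for any
mutually absolutely continuous probability measures `P₁, Q₁` one has
`D_γ(P₁ × P₂ ‖ Q₁ × Q₂) ≤ D_γ(P₁ × P₂′ ‖ Q₁ × Q₂′)` for all `γ ≥ 0`. -/
theorem hockeyStick_prod_mono
    {Ω₁ Ω₂ Ω₂' : Type*} [MeasurableSpace Ω₁] [MeasurableSpace Ω₂] [MeasurableSpace Ω₂']
    (P₁ Q₁ : Measure Ω₁) [IsProbabilityMeasure P₁] [IsProbabilityMeasure Q₁]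
    (P₂ Q₂ : Measure Ω₂) [IsProbabilityMeasure P₂] [IsProbabilityMeasure Q₂]
    (P₂' Q₂' : Measure Ω₂') [IsProbabilityMeasure P₂'] [IsProbabilityMeasure Q₂']
    (h₁ : P₁ ≪ Q₁) (h₁' : Q₁ ≪ P₁)
    (h₂ : P₂ ≪ Q₂) (h₂' : Q₂ ≪ P₂)
    (h₃ : P₂' ≪ Q₂') (h₃' : Q₂' ≪ P₂')
    (hle : ∀ γ ≥ (0 : ℝ), hockeyStick γ P₂ Q₂ ≤ hockeyStick γ P₂' Q₂') :
    ∀ γ ≥ (0 : ℝ),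
      hockeyStick γ (P₁.prod P₂) (Q₁.prod Q₂)
        ≤ hockeyStick γ (P₁.prod P₂') (Q₁.prod Q₂') := by
  intro γ hγ
  obtain ⟨i1, e1⟩ := hs_prod γ hγ P₁ Q₁ P₂ Q₂ h₁ h₂
  obtain ⟨i2, e2⟩ := hs_prod γ hγ P₁ Q₁ P₂' Q₂' h₁ h₃
  rw [e1, e2]
  exact integral_mono i1 i2 fun x => mul_le_mul_of_nonneg_left
    (hle _ (div_nonneg hγ ENNReal.toReal_nonneg)) ENNReal.toReal_nonneg
end

section
/- Let P₁, Q₁ be mutually absolutely continuous probability measures on a measurable space Ω₁ with r = dQ₁/dP₁. Let κ_P and κ_Q be Markov kernels from Ω₁ to a measurable space Ω₂, and let H₂ be a privacy profile such that for every y₁ ∈ Ω₁ and every γ ≥ 0, D_γ(κ_P(y₁) ‖ κ_Q(y₁)) ≤ H₂(γ). Then for every γ ≥ 0, D_γ(P₁ ⊗ κ_P ‖ Q₁ ⊗ κ_Q) ≤ ∫_{Ω₁} H₂(γ · r(y₁)) dP₁(y₁). -/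
open MeasureTheory ProbabilityTheory

lemma hs_int {Ω : Type*} [MeasurableSpace Ω] (γ : ℝ) (P Q : Measure Ω)
    [IsFiniteMeasure P] [IsFiniteMeasure Q] :
    Integrable (fun y => (P.rnDeriv (P + Q) y).toReal - γ * (Q.rnDeriv (P + Q) y).toReal)
      (P + Q) :=
  Measure.integrable_toReal_rnDeriv.sub (Measure.integrable_toReal_rnDeriv.const_mul γ)

lemma hs_set {Ω : Type*} [MeasurableSpace Ω] (γ : ℝ) (P Q : Measure Ω)
    [IsFiniteMeasure P] [IsFiniteMeasure Q] (A : Set Ω) :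
    ∫ y in A, ((P.rnDeriv (P + Q) y).toReal - γ * (Q.rnDeriv (P + Q) y).toReal) ∂(P + Q)
      = P.real A - γ * Q.real A := by
  have hP : P ≪ P + Q := Measure.AbsolutelyContinuous.rfl.add_right Q
  have hQ : Q ≪ P + Q := by
    rw [add_comm]; exact Measure.AbsolutelyContinuous.rfl.add_right P
  rw [integral_sub Measure.integrable_toReal_rnDeriv.integrableOn
    (Measure.integrable_toReal_rnDeriv.const_mul γ).integrableOn, integral_const_mul,
    Measure.setIntegral_toReal_rnDeriv hP, Measure.setIntegral_toReal_rnDeriv hQ]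

lemma hs_ge {Ω : Type*} [MeasurableSpace Ω] (γ : ℝ) (P Q : Measure Ω)
    [IsFiniteMeasure P] [IsFiniteMeasure Q] (A : Set Ω) :
    P.real A - γ * Q.real A ≤ hockeyStick γ P Q := by
  have hi := hs_int γ P Q
  rw [← hs_set γ P Q A, hockeyStick]
  calc _ ≤ ∫ y in A, max ((P.rnDeriv (P + Q) y).toReal - γ * (Q.rnDeriv (P + Q) y).toReal) 0
        ∂(P + Q) :=
        integral_mono hi.integrableOn hi.pos_part.integrableOn (fun y => le_max_left _ _)
    _ ≤ _ := setIntegral_le_integral hi.pos_part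
        (Filter.Eventually.of_forall fun y => le_max_right _ _)

lemma hs_attain {Ω : Type*} [MeasurableSpace Ω] (γ : ℝ) (P Q : Measure Ω)
    [IsFiniteMeasure P] [IsFiniteMeasure Q] :
    ∃ A, MeasurableSet A ∧ hockeyStick γ P Q = P.real A - γ * Q.real A := by
  have hm : Measurable
      (fun y => (P.rnDeriv (P + Q) y).toReal - γ * (Q.rnDeriv (P + Q) y).toReal) := by
    fun_prop
  have hA := measurableSet_le (measurable_const (a := (0 : ℝ))) hm
  refine ⟨_, hA, ?_⟩
  rw [← hs_set, ← integral_indicator hA, hockeyStick]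
  congr 1
  ext y
  by_cases h : 0 ≤ (P.rnDeriv (P + Q) y).toReal - γ * (Q.rnDeriv (P + Q) y).toReal
  · rw [Set.indicator_of_mem (by exact h), max_eq_left h]
  · rw [Set.indicator_of_notMem (by exact h), max_eq_right (not_le.mp h).le]

lemma cp_real {Ω₁ Ω₂ : Type*} [MeasurableSpace Ω₁] [MeasurableSpace Ω₂]
    (P : Measure Ω₁) [IsProbabilityMeasure P] (κ : Kernel Ω₁ Ω₂) [IsMarkovKernel κ]
    {A : Set (Ω₁ × Ω₂)} (hA : MeasurableSet A) :
    (P ⊗ₘ κ).real A = ∫ y, (κ y).real (Prod.mk y ⁻¹' A) ∂P := by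
  rw [measureReal_def, Measure.compProd_apply hA]
  simp only [measureReal_def]
  rw [integral_toReal (Kernel.measurable_kernel_prodMk_left hA).aemeasurable
    (Filter.Eventually.of_forall fun y => measure_lt_top _ _)]

/-- **Adaptive composition bound via a dominating privacy profile.** If `P₁, Q₁` are
mutually absolutely continuous probability measures with `r = dQ₁/dP₁`, `κP, κQ` are
Markov kernels to `Ω₂`, and `H₂` is a privacy profile dominating every pair
`(κP y₁, κQ y₁)` (i.e. `D_γ(κP y₁ ‖ κQ y₁) ≤ H₂ γ` for all `y₁` and `γ ≥ 0`), then for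
every `γ ≥ 0`, `D_γ(P₁ ⊗ κP ‖ Q₁ ⊗ κQ) ≤ ∫ H₂(γ · r(y₁)) dP₁(y₁)`. -/
theorem hockeyStick_compProd_le
    {Ω₁ Ω₂ : Type*} [MeasurableSpace Ω₁] [MeasurableSpace Ω₂]
    (P₁ Q₁ : Measure Ω₁) [IsProbabilityMeasure P₁] [IsProbabilityMeasure Q₁]
    (hPQ : P₁ ≪ Q₁) (hQP : Q₁ ≪ P₁)
    (κP κQ : Kernel Ω₁ Ω₂) [IsMarkovKernel κP] [IsMarkovKernel κQ]
    (H₂ : ℝ → ℝ) (hH₂ : IsPrivacyProfile H₂)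
    (hdom : ∀ y₁, ∀ γ ≥ (0 : ℝ), hockeyStick γ (κP y₁) (κQ y₁) ≤ H₂ γ) :
    ∀ γ ≥ (0 : ℝ),
      hockeyStick γ (P₁ ⊗ₘ κP) (Q₁ ⊗ₘ κQ)
        ≤ ∫ y₁, H₂ (γ * (Q₁.rnDeriv P₁ y₁).toReal) ∂P₁ := by
  intro γ hγ
  obtain ⟨A, hA, hEq⟩ := hs_attain γ (P₁ ⊗ₘ κP) (Q₁ ⊗ₘ κQ)
  have hmeas : ∀ (κ : Kernel Ω₁ Ω₂) [IsMarkovKernel κ],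
      Measurable fun y => (κ y).real (Prod.mk y ⁻¹' A) := fun κ _ =>
    (Kernel.measurable_kernel_prodMk_left hA).ennreal_toReal
  have hb : ∀ (κ : Kernel Ω₁ Ω₂) [IsMarkovKernel κ] (y : Ω₁),
      ‖(κ y).real (Prod.mk y ⁻¹' A)‖ ≤ 1 := fun κ _ y => by
    rw [Real.norm_of_nonneg measureReal_nonneg]; exact measureReal_le_one
  have hr : Integrable (fun y => (Q₁.rnDeriv P₁ y).toReal) P₁ :=
    Measure.integrable_toReal_rnDeriv
  have i1 : Integrable (fun y => (κP y).real (Prod.mk y ⁻¹' A)) P₁ :=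
    Integrable.of_bound (hmeas κP).aestronglyMeasurable 1 (Filter.Eventually.of_forall (hb κP))
  have i2 : Integrable
      (fun y => (Q₁.rnDeriv P₁ y).toReal * (κQ y).real (Prod.mk y ⁻¹' A)) P₁ :=
    hr.mul_bdd (c := 1) (hmeas κQ).aestronglyMeasurable (Filter.Eventually.of_forall (hb κQ))
  have e2 : ∫ y, (κQ y).real (Prod.mk y ⁻¹' A) ∂Q₁
      = ∫ y, (Q₁.rnDeriv P₁ y).toReal * (κQ y).real (Prod.mk y ⁻¹' A) ∂P₁ := by
    rw [← integral_rnDeriv_smul hQP]; rfl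
  obtain ⟨-, hanti, -, hbd⟩ := hH₂
  have hnn : ∀ y, 0 ≤ γ * (Q₁.rnDeriv P₁ y).toReal := fun y =>
    mul_nonneg hγ ENNReal.toReal_nonneg
  have hHm : Measurable fun x => H₂ (max x 0) := by
    apply Antitone.measurable
    intro a b hab
    exact hanti (Set.mem_Ici.2 (le_max_right _ _)) (Set.mem_Ici.2 (le_max_right _ _)) (max_le_max_right 0 hab)
  have i3 : Integrable (fun y => H₂ (γ * (Q₁.rnDeriv P₁ y).toReal)) P₁ := by
    have hm : Measurable fun y => H₂ (γ * (Q₁.rnDeriv P₁ y).toReal) := by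
      have h := hHm.comp (g := fun x => H₂ (max x 0))
        (f := fun y => γ * (Q₁.rnDeriv P₁ y).toReal) (by fun_prop)
      convert h using 2 with y
      simp [max_eq_left (hnn y)]
    refine Integrable.of_bound hm.aestronglyMeasurable 1 (Filter.Eventually.of_forall fun y => ?_)
    have h := hbd _ (hnn y)
    rw [Real.norm_of_nonneg ((le_max_right _ _).trans h.1)]
    exact h.2
  rw [hEq, cp_real P₁ κP hA, cp_real Q₁ κQ hA, e2, ← integral_const_mul,
    ← integral_sub i1 (i2.const_mul γ)]
  refine integral_mono (i1.sub (i2.const_mul γ)) i3 fun y => ?_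
  have h := (hs_ge (γ * (Q₁.rnDeriv P₁ y).toReal) (κP y) (κQ y) (Prod.mk y ⁻¹' A)).trans
    (hdom y _ (hnn y))
  simpa only [mul_assoc] using h
end

section
/- There exist constants C > 0 and q₀ ∈ (0,1), depending on n, σ and h, such that for all q ∈ (0, q₀]: |E_{P_q}[L_q] − (1/2)·q²·(e^{μ²/σ²} − 1)| ≤ C·q³ and |E_{Q_q}[L_q] + (1/2)·q²·(e^{μ²/σ²} − 1)| ≤ C·q³. That is, as q → 0, the mean of the privacy loss of the Poisson-subsampled Gaussian mechanism under P is (1/2)q²(e^{μ²/σ²} − 1) + O(q³) and under Q is −(1/2)q²(e^{μ²/σ²} − 1) + O(q³). -/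
open MeasureTheory ProbabilityTheory

/-- The Poisson-subsampled Gaussian output distribution on the dataset `S = {0,…,n}`:
`P_q = Σ_{J ⊆ {0,…,n}} q^{|J|} (1−q)^{n+1−|J|} · N(h(J), σ²)`. -/
noncomputable def subsampledP (n : ℕ) (σ q : ℝ) (h : Finset ℕ → ℝ) : Measure ℝ :=
  ∑ J ∈ (Finset.range (n + 1)).powerset,
    ENNReal.ofReal (q ^ J.card * (1 - q) ^ (n + 1 - J.card)) •
      gaussianReal (h J) (σ ^ 2).toNNReal

/-- The Poisson-subsampled Gaussian output distribution on the dataset `S⁻ = {0,…,n−1}`: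
`Q_q = Σ_{J ⊆ {0,…,n−1}} q^{|J|} (1−q)^{n−|J|} · N(h(J), σ²)`. -/
noncomputable def subsampledQ (n : ℕ) (σ q : ℝ) (h : Finset ℕ → ℝ) : Measure ℝ :=
  ∑ J ∈ (Finset.range n).powerset,
    ENNReal.ofReal (q ^ J.card * (1 - q) ^ (n - J.card)) •
      gaussianReal (h J) (σ ^ 2).toNNReal

/-- The privacy loss `L_q = ln(dP_q/dQ_q)` of the Poisson-subsampled Gaussian
mechanism. -/
noncomputable def privacyLoss (n : ℕ) (σ q : ℝ) (h : Finset ℕ → ℝ) (y : ℝ) : ℝ :=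
  Real.log (((subsampledP n σ q h).rnDeriv (subsampledQ n σ q h) y).toReal)


lemma aux_log (x : ℝ) (hx : -(1/2) ≤ x) :
    |Real.log (1 + x) - x + x ^ 2 / 2| ≤ 5 * |x| ^ 3 := by
  by_cases h : |x| ≤ 1 / 2
  · have h1 := Real.abs_log_sub_add_sum_range_le (x := -x) (by rw [abs_neg]; linarith) 2
    simp only [Finset.sum_range_succ, Finset.sum_range_zero, abs_neg] at h1
    have h2 : |x| ^ (2 + 1) / (1 - |x|) ≤ 5 * |x| ^ 3 := by
      rw [div_le_iff₀ (by linarith)]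
      have : 0 ≤ |x| ^ 3 := by positivity
      norm_num
      nlinarith
    refine le_trans (le_of_eq ?_) (h1.trans h2)
    congr 1
    rw [sub_neg_eq_add]
    push_cast
    ring
  · have hx2 : 1 / 2 < x := by
      rcases abs_cases x with ⟨h1, h2⟩ | ⟨h1, h2⟩ <;> linarith
    have h1 : Real.log (1 + x) ≤ x := by
      have := Real.log_le_sub_one_of_pos (show 0 < 1 + x by linarith)
      linarith
    have h2 : 0 ≤ Real.log (1 + x) := Real.log_nonneg (by linarith)
    rw [abs_of_pos (by linarith : 0 < x), abs_le]
    have h3 : x ≤ 4 * x ^ 3 := by nlinarith [mul_pos (show 0 < x by linarith) (show 0 < x - 1/2 by linarith)]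
    have h4 : x ^ 2 / 2 ≤ x ^ 3 := by nlinarith [sq_nonneg x]
    constructor <;> nlinarith [sq_nonneg x]

lemma aux_pt (q c K G B D r : ℝ) (hq : 0 < q) (hq2 : q ≤ 1 / 2) (hc : 0 < c) (hK : 0 ≤ K)
    (hG : 1 ≤ G) (hcB : c ≤ B) (hBG : B ≤ G) (hD : 0 ≤ D) (hDG : D ≤ G) (hr : 0 ≤ r) (hrG : r ≤ G)
    (hB1 : |B - 1| ≤ q * K * G) (hDr : |D - r| ≤ q * K * G) :
    |B * Real.log (((1 - q) * B + q * D) / B) - (q * (D - B) - q ^ 2 / 2 * (r - 1) ^ 2)|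
      ≤ (K * (1 / c + 4) / 2 + 1 / (2 * c ^ 3) + (1 + 1 / c) * (5 / c ^ 3)) * q ^ 3 * G ^ 5 ∧
    |((1 - q) * B + q * D) * Real.log (((1 - q) * B + q * D) / B)
        - (q * (D - B) + q ^ 2 / 2 * (r - 1) ^ 2)|
      ≤ (K * (1 / c + 4) / 2 + 1 / (2 * c ^ 3) + (1 + 1 / c) * (5 / c ^ 3)) * q ^ 3 * G ^ 5 := by
  have hB : 0 < B := hc.trans_le hcB
  have hG0 : 0 < G := by linarith
  obtain ⟨X, hX⟩ : ∃ X, X = q * (D - B) / B := ⟨_, rfl⟩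
  have hBX : B * X = q * (D - B) := by rw [hX]; field_simp
  have hA : (1 - q) * B + q * D = B * (1 + X) := by linarith
  have hAB : ((1 - q) * B + q * D) / B = 1 + X := by rw [hA]; field_simp
  have ha : |D - B| ≤ G := by rw [abs_le]; constructor <;> linarith
  have hb : |r - 1| ≤ G := by rw [abs_le]; constructor <;> linarith
  have hXlow : -(1/2) ≤ X := by
    rw [hX, le_div_iff₀ hB]; nlinarith
  have hXabs : |X| ≤ q * (G / c) := by
    rw [hX, abs_div, abs_mul, abs_of_pos hq, abs_of_pos hB, mul_div_assoc]
    gcongr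
  obtain ⟨e, he⟩ : ∃ e, e = Real.log (1 + X) - X + X ^ 2 / 2 := ⟨_, rfl⟩
  have hlog : Real.log (1 + X) = X - X ^ 2 / 2 + e := by linarith
  have hX3 : |X| ^ 3 ≤ q ^ 3 * G ^ 3 / c ^ 3 := by
    calc |X| ^ 3 ≤ (q * (G / c)) ^ 3 := by gcongr
      _ = _ := by field_simp
  have he1 : |e| ≤ 5 * (q ^ 3 * G ^ 3 / c ^ 3) := by
    rw [he]; exact (aux_log X hXlow).trans (by gcongr)
  -- second-order term
  have hS : |B * X ^ 2 - q ^ 2 * (r - 1) ^ 2| ≤ q ^ 3 * (K * (1 / c + 4)) * G ^ 3 := by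
    have e1 : B * X ^ 2 - q ^ 2 * (r - 1) ^ 2
        = q ^ 2 * ((D - B) ^ 2 * (1 - B) / B + ((D - r) - (B - 1)) * ((D - B) + (r - 1))) := by
      rw [hX]; field_simp; ring
    rw [e1, abs_mul, abs_of_pos (by positivity : 0 < q ^ 2)]
    have t1 : |(D - B) ^ 2 * (1 - B) / B| ≤ G ^ 2 * (q * K * G) / c := by
      rw [abs_div, abs_mul, abs_pow, abs_sub_comm 1 B, abs_of_pos hB]
      gcongr
    have t2 : |((D - r) - (B - 1)) * ((D - B) + (r - 1))| ≤ (2 * (q * K * G)) * (2 * G) := by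
      rw [abs_mul]
      gcongr
      · exact (abs_sub _ _).trans (by linarith)
      · exact (abs_add_le _ _).trans (by linarith)
    have t3 : (2 * (q * K * G)) * (2 * G) ≤ 4 * q * K * G ^ 3 := by
      have : 0 ≤ q * K * G ^ 2 := by positivity
      nlinarith
    calc q ^ 2 * _ ≤ q ^ 2 * (G ^ 2 * (q * K * G) / c + 4 * q * K * G ^ 3) := by
          gcongr
          exact (abs_add_le _ _).trans (by linarith)
      _ = _ := by field_simp
  have p35 : G ^ 3 ≤ G ^ 5 := pow_le_pow_right₀ hG (by norm_num)
  have p45 : G ^ 4 ≤ G ^ 5 := pow_le_pow_right₀ hG (by norm_num)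
  have hS' : q ^ 3 * (K * (1 / c + 4)) * G ^ 3 ≤ q ^ 3 * (K * (1 / c + 4)) * G ^ 5 := by gcongr
  have h1X : |1 + X| ≤ (1 + 1 / c) * G := by
    refine (abs_add_le _ _).trans ?_
    have : q * (G / c) ≤ 1 * (G / c) := by gcongr; linarith
    rw [abs_one]
    calc 1 + |X| ≤ G + G / c := by linarith
      _ = _ := by ring
  have hBe : |B * e| ≤ 5 / c ^ 3 * q ^ 3 * G ^ 5 := by
    rw [abs_mul, abs_of_pos hB]
    calc B * |e| ≤ G * (5 * (q ^ 3 * G ^ 3 / c ^ 3)) := by gcongr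
      _ = 5 / c ^ 3 * q ^ 3 * G ^ 4 := by ring
      _ ≤ _ := by gcongr
  have hBe2 : |B * (1 + X) * e| ≤ (1 + 1 / c) * (5 / c ^ 3) * q ^ 3 * G ^ 5 := by
    rw [abs_mul, abs_mul, abs_of_pos hB]
    calc B * |1 + X| * |e| ≤ G * ((1 + 1 / c) * G) * (5 * (q ^ 3 * G ^ 3 / c ^ 3)) := by gcongr
      _ = _ := by ring
  have hBX3 : |B * X ^ 3| ≤ 1 / c ^ 3 * q ^ 3 * G ^ 5 := by
    rw [abs_mul, abs_of_pos hB, abs_pow]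
    calc B * |X| ^ 3 ≤ G * (q ^ 3 * G ^ 3 / c ^ 3) := by gcongr
      _ = 1 / c ^ 3 * q ^ 3 * G ^ 4 := by ring
      _ ≤ _ := by gcongr
  have x1 : 0 ≤ 1 / (2 * c ^ 3) * q ^ 3 * G ^ 5 := by positivity
  have x2 : 0 ≤ 1 / c * (5 / c ^ 3) * q ^ 3 * G ^ 5 := by positivity
  have x3 : 1 / (2 * c ^ 3) * q ^ 3 * G ^ 5 = (1 / c ^ 3 * q ^ 3 * G ^ 5) / 2 := by field_simp
  rw [hAB, hlog, hA]
  rw [abs_le] at hS hBe hBe2 hBX3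
  constructor
  · have : B * (X - X ^ 2 / 2 + e) - (q * (D - B) - q ^ 2 / 2 * (r - 1) ^ 2)
      = - (B * X ^ 2 - q ^ 2 * (r - 1) ^ 2) / 2 + B * e := by rw [← hBX]; ring
    rw [this, abs_le]
    constructor <;> linarith [hS.1, hS.2, hBe.1, hBe.2]
  · have : B * (1 + X) * (X - X ^ 2 / 2 + e) - (q * (D - B) + q ^ 2 / 2 * (r - 1) ^ 2)
      = (B * X ^ 2 - q ^ 2 * (r - 1) ^ 2) / 2 - (B * X ^ 3) / 2 + B * (1 + X) * e := by
        rw [← hBX]; ring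
    rw [this, abs_le]
    constructor <;> linarith [hS.1, hS.2, hBe2.1, hBe2.2, hBX3.1, hBX3.2]

lemma aux_wsum (n : ℕ) (q : ℝ) :
    ∑ J ∈ (Finset.range n).powerset, q ^ J.card * (1 - q) ^ (n - J.card) = 1 := by
  have := Finset.sum_pow_mul_eq_add_pow q (1 - q) (Finset.range n)
  simp only [Finset.card_range] at this
  rw [this]; simp

lemma aux_avg (n : ℕ) (q G : ℝ) (hq : 0 < q) (hq2 : q ≤ 1 / 2) (f : Finset ℕ → ℝ)
    (hf : ∀ J ∈ (Finset.range n).powerset, 0 ≤ f J ∧ f J ≤ G) :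
    |∑ J ∈ (Finset.range n).powerset, q ^ J.card * (1 - q) ^ (n - J.card) * f J - f ∅|
      ≤ q * 2 ^ n * G := by
  have e1 : ∑ J ∈ (Finset.range n).powerset, q ^ J.card * (1 - q) ^ (n - J.card) * f J - f ∅
      = ∑ J ∈ (Finset.range n).powerset, q ^ J.card * (1 - q) ^ (n - J.card) * (f J - f ∅) := by
    simp only [mul_sub, Finset.sum_sub_distrib]
    rw [← Finset.sum_mul, aux_wsum, one_mul]
  have h0 := hf ∅ (by simp)
  rw [e1]
  refine (Finset.abs_sum_le_sum_abs _ _).trans ?_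
  calc _ ≤ ∑ J ∈ (Finset.range n).powerset, q * G := by
        refine Finset.sum_le_sum fun J hJ => ?_
        have hJ' := hf J hJ
        by_cases hE : J = ∅
        · subst hE
          simp
          nlinarith
        · rw [abs_mul]
          have hp : 0 ≤ (1 - q) ^ (n - J.card) := pow_nonneg (by linarith) _
          have hp1 : (1 - q) ^ (n - J.card) ≤ 1 := pow_le_one₀ (by linarith) (by linarith)
          have hq1 : q ^ J.card ≤ q :=
            pow_le_of_le_one hq.le (by linarith) (by simpa using hE)
          rw [abs_of_nonneg (by positivity)]
          have : |f J - f ∅| ≤ G := by rw [abs_le]; constructor <;> linarith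
          have : q ^ J.card * (1 - q) ^ (n - J.card) ≤ q * 1 := by gcongr
          rw [mul_one] at this
          gcongr
    _ = _ := by simp; ring

lemma aux_avg_mem (n : ℕ) (q G : ℝ) (hq : 0 < q) (hq2 : q ≤ 1 / 2) (f : Finset ℕ → ℝ)
    (hf : ∀ J ∈ (Finset.range n).powerset, 0 ≤ f J ∧ f J ≤ G) :
    (1 / 2) ^ n * f ∅ ≤ ∑ J ∈ (Finset.range n).powerset,
        q ^ J.card * (1 - q) ^ (n - J.card) * f J ∧
    ∑ J ∈ (Finset.range n).powerset, q ^ J.card * (1 - q) ^ (n - J.card) * f J ≤ G := by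
  have hp : ∀ J : Finset ℕ, 0 ≤ q ^ J.card * (1 - q) ^ (n - J.card) := fun J =>
    mul_nonneg (pow_nonneg hq.le _) (pow_nonneg (by linarith) _)
  constructor
  · have h0 := hf ∅ (by simp)
    have h1 := Finset.single_le_sum (s := (Finset.range n).powerset)
      (f := fun J => q ^ J.card * (1 - q) ^ (n - J.card) * f J)
      (fun J hJ => mul_nonneg (hp J) (hf J hJ).1) (show ∅ ∈ (Finset.range n).powerset by simp)
    refine le_trans ?_ h1
    simp
    have := h0.1
    gcongr
    rw [← inv_pow]
    gcongr
    linarith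
  · calc _ ≤ ∑ J ∈ (Finset.range n).powerset, q ^ J.card * (1 - q) ^ (n - J.card) * G :=
          Finset.sum_le_sum fun J hJ => mul_le_mul_of_nonneg_left (hf J hJ).2 (hp J)
      _ = G := by rw [← Finset.sum_mul, aux_wsum, one_mul]

/-- likelihood ratio -/
noncomputable def auxR (σ m y : ℝ) : ℝ := Real.exp (m / σ ^ 2 * y - m ^ 2 / (2 * σ ^ 2))

lemma auxR_pos (σ m y : ℝ) : 0 < auxR σ m y := Real.exp_pos _

lemma auxR_zero (σ y : ℝ) : auxR σ 0 y = 1 := by simp [auxR]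

lemma auxR_meas (σ m : ℝ) : Measurable (auxR σ m) := by unfold auxR; fun_prop

lemma aux_v (σ : ℝ) : (((σ ^ 2).toNNReal : NNReal) : ℝ) = σ ^ 2 := Real.coe_toNNReal _ (sq_nonneg _)

lemma aux_int_exp (σ a : ℝ) :
    ∫ y, Real.exp (a * y) ∂(gaussianReal 0 (σ ^ 2).toNNReal) = Real.exp (σ ^ 2 * a ^ 2 / 2) := by
  have := congrFun (mgf_fun_id_gaussianReal (μ := 0) (v := (σ ^ 2).toNNReal)) a
  rw [mgf, aux_v] at this
  rw [this]; simp

lemma auxR_pow (σ m y : ℝ) (k : ℕ) :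
    auxR σ m y ^ k = Real.exp (k * (m / σ ^ 2) * y) * Real.exp (- (k * (m ^ 2 / (2 * σ ^ 2)))) := by
  rw [auxR, ← Real.exp_nat_mul, ← Real.exp_add]; ring_nf

lemma auxR_pow_integrable (σ m : ℝ) (k : ℕ) :
    Integrable (fun y => auxR σ m y ^ k) (gaussianReal 0 (σ ^ 2).toNNReal) := by
  simp only [auxR_pow]
  exact (integrable_exp_mul_gaussianReal _).mul_const _

lemma auxR_integrable (σ m : ℝ) :
    Integrable (fun y => auxR σ m y) (gaussianReal 0 (σ ^ 2).toNNReal) := by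
  simpa using auxR_pow_integrable σ m 1

lemma auxR_integral (σ m : ℝ) (hσ : 0 < σ) :
    ∫ y, auxR σ m y ∂(gaussianReal 0 (σ ^ 2).toNNReal) = 1 := by
  have : ∀ y, auxR σ m y = _ := fun y => by rw [← pow_one (auxR σ m y), auxR_pow]
  simp only [this]
  rw [integral_mul_const, aux_int_exp, ← Real.exp_add, Real.exp_eq_one_iff]
  push_cast
  field_simp
  ring

lemma auxR_integral_sq (σ m : ℝ) (hσ : 0 < σ) :
    ∫ y, auxR σ m y ^ 2 ∂(gaussianReal 0 (σ ^ 2).toNNReal) = Real.exp (m ^ 2 / σ ^ 2) := by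
  simp only [auxR_pow]
  rw [integral_mul_const, aux_int_exp, ← Real.exp_add]
  congr 1
  push_cast
  field_simp
  ring

lemma auxR_sub_sq_integrable (σ m : ℝ) :
    Integrable (fun y => (auxR σ m y - 1) ^ 2) (gaussianReal 0 (σ ^ 2).toNNReal) := by
  have : (fun y => (auxR σ m y - 1) ^ 2) = fun y => auxR σ m y ^ 2 - 2 * auxR σ m y + 1 := by
    ext y; ring
  rw [this]
  exact ((auxR_pow_integrable σ m 2).sub ((auxR_integrable σ m).const_mul 2)).add
    (integrable_const _)

lemma auxR_sub_sq_integral (σ m : ℝ) (hσ : 0 < σ) :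
    ∫ y, (auxR σ m y - 1) ^ 2 ∂(gaussianReal 0 (σ ^ 2).toNNReal)
      = Real.exp (m ^ 2 / σ ^ 2) - 1 := by
  have : (fun y => (auxR σ m y - 1) ^ 2) = fun y => auxR σ m y ^ 2 - 2 * auxR σ m y + 1 := by
    ext y; ring
  have hi : Integrable (fun y => auxR σ m y ^ 2 - 2 * auxR σ m y)
      (gaussianReal 0 (σ ^ 2).toNNReal) :=
    (auxR_pow_integrable σ m 2).sub ((auxR_integrable σ m).const_mul 2)
  rw [this, integral_add hi (integrable_const _),
    integral_sub (auxR_pow_integrable σ m 2) ((auxR_integrable σ m).const_mul 2),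
    integral_const_mul, auxR_integral σ m hσ, auxR_integral_sq σ m hσ]
  simp
  ring

lemma auxR_memLp (σ m : ℝ) (k : ℕ) (hk : k ≠ 0) :
    MemLp (fun y => auxR σ m y) k (gaussianReal 0 (σ ^ 2).toNNReal) := by
  have hk' : (k : ENNReal) ≠ 0 := by exact_mod_cast hk
  rw [← integrable_norm_rpow_iff (auxR_meas σ m).aestronglyMeasurable hk' (by simp)]
  refine (auxR_pow_integrable σ m k).congr (ae_of_all _ fun y => ?_)
  simp [abs_of_pos (auxR_pos σ m y)]

lemma aux_gauss (σ m : ℝ) (hσ : 0 < σ) :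
    gaussianReal m (σ ^ 2).toNNReal = (gaussianReal 0 (σ ^ 2).toNNReal).withDensity
      (fun y => ENNReal.ofReal (auxR σ m y)) := by
  have hv : (σ ^ 2).toNNReal ≠ 0 := by
    simp only [ne_eq, Real.toNNReal_eq_zero, not_le]; positivity
  rw [gaussianReal_of_var_ne_zero m hv, gaussianReal_of_var_ne_zero 0 hv,
    ← withDensity_mul _ (measurable_gaussianPDF _ _) (auxR_meas σ m).ennreal_ofReal]
  congr 1
  ext y
  simp only [Pi.mul_apply, gaussianPDF]
  rw [← ENNReal.ofReal_mul (gaussianPDFReal_nonneg _ _ _)]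
  congr 1
  simp only [gaussianPDFReal, aux_v, auxR]
  rw [mul_assoc (√_)⁻¹, ← Real.exp_add]
  congr 2
  field_simp
  ring

lemma aux_mix (σ : ℝ) (hσ : 0 < σ) (s : Finset (Finset ℕ)) (w h : Finset ℕ → ℝ)
    (hw : ∀ J, 0 ≤ w J) :
    ∑ J ∈ s, ENNReal.ofReal (w J) • gaussianReal (h J) (σ ^ 2).toNNReal
      = (gaussianReal 0 (σ ^ 2).toNNReal).withDensity
        (fun y => ENNReal.ofReal (∑ J ∈ s, w J * auxR σ (h J) y)) := by
  classical
  induction s using Finset.induction_on with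
  | empty => simp
  | insert J s hJ ih =>
    rw [Finset.sum_insert hJ, ih, aux_gauss σ (h J) hσ,
      ← withDensity_smul _ (auxR_meas σ _).ennreal_ofReal, ← withDensity_add_left]
    · congr 1
      ext y
      simp only [Pi.add_apply, Pi.smul_apply, smul_eq_mul]
      rw [Finset.sum_insert hJ, ENNReal.ofReal_add, ENNReal.ofReal_mul (hw J)]
      · exact mul_nonneg (hw J) (auxR_pos _ _ _).le
      · exact Finset.sum_nonneg fun i _ => mul_nonneg (hw i) (auxR_pos _ _ _).le
    · exact ((auxR_meas σ _).ennreal_ofReal).const_smul _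

lemma aux_loss (ν P Q : Measure ℝ) [IsProbabilityMeasure ν] (A B : ℝ → ℝ) (hA : Measurable A)
    (hB : Measurable B) (hA0 : ∀ y, 0 < A y) (hB0 : ∀ y, 0 < B y)
    (hP : P = ν.withDensity fun y => ENNReal.ofReal (A y))
    (hQ : Q = ν.withDensity fun y => ENNReal.ofReal (B y)) :
    ∫ y, Real.log ((P.rnDeriv Q y).toReal) ∂P = ∫ y, A y * Real.log (A y / B y) ∂ν ∧
    ∫ y, Real.log ((P.rnDeriv Q y).toReal) ∂Q = ∫ y, B y * Real.log (A y / B y) ∂ν := by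
  have hAB : Measurable fun y => ENNReal.ofReal (A y / B y) := (hA.div hB).ennreal_ofReal
  have hPQ : P = Q.withDensity fun y => ENNReal.ofReal (A y / B y) := by
    rw [hP, hQ, ← withDensity_mul _ hB.ennreal_ofReal hAB]
    congr 1
    ext y
    simp only [Pi.mul_apply]
    rw [← ENNReal.ofReal_mul (hB0 y).le]
    congr 1
    have := (hB0 y).ne'
    field_simp
  have : SigmaFinite Q := by
    rw [hQ]; exact SigmaFinite.withDensity_of_ne_top (ae_of_all _ fun y => ENNReal.ofReal_ne_top)
  have hae : P.rnDeriv Q =ᵐ[Q] fun y => ENNReal.ofReal (A y / B y) := by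
    conv_lhs => rw [hPQ]
    exact Measure.rnDeriv_withDensity Q hAB
  have hac : P ≪ Q := by rw [hPQ]; exact withDensity_absolutelyContinuous _ _
  have hae2 : ∀ᵐ y ∂Q, Real.log ((P.rnDeriv Q y).toReal) = Real.log (A y / B y) := by
    filter_upwards [hae] with y hy
    rw [hy, ENNReal.toReal_ofReal (div_pos (hA0 y) (hB0 y)).le]
  constructor
  · rw [integral_congr_ae (hac.ae_le hae2), hP,
      integral_withDensity_eq_integral_toReal_smul hA.ennreal_ofReal
        (ae_of_all _ fun y => ENNReal.ofReal_lt_top)]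
    simp only [ENNReal.toReal_ofReal (hA0 _).le, smul_eq_mul]
  · rw [integral_congr_ae hae2, hQ,
      integral_withDensity_eq_integral_toReal_smul hB.ennreal_ofReal
        (ae_of_all _ fun y => ENNReal.ofReal_lt_top)]
    simp only [ENNReal.toReal_ofReal (hB0 _).le, smul_eq_mul]

lemma aux_intbound (ν : Measure ℝ) (F g H : ℝ → ℝ) (hF : Measurable F) (hg : Integrable g ν)
    (hH : Integrable H ν) (hb : ∀ y, |F y - g y| ≤ H y) :
    |∫ y, F y ∂ν - ∫ y, g y ∂ν| ≤ ∫ y, H y ∂ν := by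
  have hd : Integrable (fun y => F y - g y) ν :=
    hH.mono' (hF.aestronglyMeasurable.sub hg.aestronglyMeasurable) (ae_of_all _ hb)
  have hFi : Integrable F ν := by
    have := hd.add hg
    refine this.congr (ae_of_all _ fun y => ?_)
    simp
  rw [← integral_sub hFi hg]
  exact norm_integral_le_of_norm_le (f := fun y => F y - g y) hH (ae_of_all _ hb)

lemma aux_sum_memLp (σ : ℝ) (k : ℕ) (hk : k ≠ 0) (s : Finset (Finset ℕ)) (h : Finset ℕ → ℝ) :
    MemLp (fun y => 1 + ∑ J ∈ s, auxR σ (h J) y) k (gaussianReal 0 (σ ^ 2).toNNReal) := by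
  have h1 : MemLp (fun _ : ℝ => (1 : ℝ)) k (gaussianReal 0 (σ ^ 2).toNNReal) := memLp_const 1
  have h2 : MemLp (fun y => ∑ J ∈ s, auxR σ (h J) y) k (gaussianReal 0 (σ ^ 2).toNNReal) :=
    memLp_finset_sum s fun J _ => auxR_memLp σ (h J) k hk
  exact h1.add h2

/-- **Small sampling-rate approximation of the mean privacy loss of the
Poisson-subsampled Gaussian mechanism.**  With `μ = |h {n}|`, as `q → 0`:
`E_{P_q} L_q = ½ q² (e^{μ²/σ²} − 1) + O(q³)` and
`E_{Q_q} L_q = −½ q² (e^{μ²/σ²} − 1) + O(q³)`. -/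
theorem subsampledGaussian_mean_privacyLoss_small_q
    (n : ℕ) (σ : ℝ) (hσ : 0 < σ) (h : Finset ℕ → ℝ) (h0 : h ∅ = 0) :
    ∃ C > (0 : ℝ), ∃ q₀ ∈ Set.Ioo (0 : ℝ) 1, ∀ q ∈ Set.Ioc (0 : ℝ) q₀,
      |(∫ y, privacyLoss n σ q h y ∂(subsampledP n σ q h)) -
          1 / 2 * q ^ 2 * (Real.exp ((h {n}) ^ 2 / σ ^ 2) - 1)| ≤ C * q ^ 3 ∧
      |(∫ y, privacyLoss n σ q h y ∂(subsampledQ n σ q h)) +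
          1 / 2 * q ^ 2 * (Real.exp ((h {n}) ^ 2 / σ ^ 2) - 1)| ≤ C * q ^ 3 := by
  classical
  set ν := gaussianReal 0 (σ ^ 2).toNNReal with hν
  obtain ⟨G, hGdef⟩ : ∃ G : ℝ → ℝ, G = fun y => 1 + ∑ J ∈ (Finset.range (n + 1)).powerset,
    auxR σ (h J) y := ⟨_, rfl⟩
  have hG1 : ∀ y, 1 ≤ G y := fun y => by
    rw [hGdef]
    have := Finset.sum_nonneg (s := (Finset.range (n + 1)).powerset)
      (fun J _ => (auxR_pos σ (h J) y).le)
    simp only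
    linarith
  have hGR : ∀ y, ∀ J ∈ (Finset.range (n + 1)).powerset, auxR σ (h J) y ≤ G y := fun y J hJ => by
    have := Finset.single_le_sum (s := (Finset.range (n + 1)).powerset)
      (f := fun J => auxR σ (h J) y) (fun J _ => (auxR_pos σ (h J) y).le) hJ
    rw [hGdef]
    simp only at this ⊢
    linarith
  have hGint : Integrable (fun y => G y ^ 5) ν := by
    have hm : MemLp G (5 : ℕ) ν := by
      rw [hGdef]
      exact aux_sum_memLp σ 5 (by norm_num) _ h
    refine (hm.integrable_norm_pow (by norm_num)).congr (ae_of_all _ fun y => ?_)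
    simp only [Real.norm_eq_abs]
    rw [abs_of_pos (by linarith [hG1 y])]
  obtain ⟨c, hc⟩ : ∃ c : ℝ, c = (1 / 2) ^ n := ⟨_, rfl⟩
  have hc0 : 0 < c := by rw [hc]; positivity
  obtain ⟨K, hK⟩ : ∃ K : ℝ, K = 2 ^ n := ⟨_, rfl⟩
  have hK0 : 0 ≤ K := by rw [hK]; positivity
  obtain ⟨M, hM⟩ : ∃ M : ℝ, M =
    (K * (1 / c + 4) / 2 + 1 / (2 * c ^ 3) + (1 + 1 / c) * (5 / c ^ 3)) := ⟨_, rfl⟩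
  have hM0 : 0 < M := by rw [hM]; positivity
  have hI0 : 0 ≤ ∫ y, G y ^ 5 ∂ν := integral_nonneg fun y => by
    have := hG1 y
    positivity
  refine ⟨M * (∫ y, G y ^ 5 ∂ν) + 1, by positivity, 1 / 2, by norm_num, ?_⟩
  rintro q ⟨hq, hq2⟩
  obtain ⟨w, hw⟩ : ∃ w : Finset ℕ → ℝ, w = fun J => q ^ J.card * (1 - q) ^ (n - J.card) := ⟨_, rfl⟩
  have hw0 : ∀ J, 0 ≤ w J := fun J => by
    rw [hw]; exact mul_nonneg (pow_nonneg hq.le _) (pow_nonneg (by linarith) _)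
  obtain ⟨B, hB⟩ : ∃ B : ℝ → ℝ, B = fun y => ∑ J ∈ (Finset.range n).powerset,
    w J * auxR σ (h J) y := ⟨_, rfl⟩
  obtain ⟨D, hD⟩ : ∃ D : ℝ → ℝ, D = fun y => ∑ J ∈ (Finset.range n).powerset,
    w J * auxR σ (h (insert n J)) y := ⟨_, rfl⟩
  have hsub1 : ∀ J ∈ (Finset.range n).powerset, J ∈ (Finset.range (n + 1)).powerset := by
    intro J hJ
    rw [Finset.mem_powerset] at hJ ⊢
    exact hJ.trans (Finset.range_mono (by omega))
  have hsub2 : ∀ J ∈ (Finset.range n).powerset, insert n J ∈ (Finset.range (n + 1)).powerset := by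
    intro J hJ
    rw [Finset.mem_powerset] at hJ ⊢
    rw [Finset.range_add_one]
    exact Finset.insert_subset_insert _ hJ
  have hBm : Measurable B := by
    rw [hB]
    exact Finset.measurable_sum _ fun J _ => (auxR_meas σ _).const_mul _
  have hDm : Measurable D := by
    rw [hD]
    exact Finset.measurable_sum _ fun J _ => (auxR_meas σ _).const_mul _
  have hBi : Integrable B ν := by
    rw [hB]
    exact integrable_finset_sum _ fun J _ => (auxR_integrable σ _).const_mul _
  have hDi : Integrable D ν := by
    rw [hD]
    exact integrable_finset_sum _ fun J _ => (auxR_integrable σ _).const_mul _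
  have hws : ∑ J ∈ (Finset.range n).powerset, w J = 1 := by rw [hw]; exact aux_wsum n q
  have hB1 : ∫ y, B y ∂ν = 1 := by
    rw [hB, integral_finset_sum _ fun J _ => (auxR_integrable σ _).const_mul _]
    simp only [integral_const_mul, auxR_integral σ _ hσ, hν, mul_one, hws]
  have hD1 : ∫ y, D y ∂ν = 1 := by
    rw [hD, integral_finset_sum _ fun J _ => (auxR_integrable σ _).const_mul _]
    simp only [integral_const_mul, auxR_integral σ _ hσ, hν, mul_one, hws]
  have hfB : ∀ y, ∀ J ∈ (Finset.range n).powerset,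
      0 ≤ auxR σ (h J) y ∧ auxR σ (h J) y ≤ G y := fun y J hJ =>
    ⟨(auxR_pos _ _ _).le, hGR y J (hsub1 J hJ)⟩
  have hfD : ∀ y, ∀ J ∈ (Finset.range n).powerset,
      0 ≤ auxR σ (h (insert n J)) y ∧ auxR σ (h (insert n J)) y ≤ G y := fun y J hJ =>
    ⟨(auxR_pos _ _ _).le, hGR y _ (hsub2 J hJ)⟩
  have hBb : ∀ y, c ≤ B y ∧ B y ≤ G y ∧ |B y - 1| ≤ q * K * G y := fun y => by
    have a1 := aux_avg_mem n q (G y) hq hq2 (fun J => auxR σ (h J) y) (hfB y)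
    have a2 := aux_avg n q (G y) hq hq2 (fun J => auxR σ (h J) y) (hfB y)
    simp only [h0, auxR_zero, mul_one] at a1 a2
    rw [hB, hw, hc, hK]
    exact ⟨a1.1, a1.2, a2⟩
  have hDb : ∀ y, 0 ≤ D y ∧ D y ≤ G y ∧ |D y - auxR σ (h {n}) y| ≤ q * K * G y := fun y => by
    have a1 := aux_avg_mem n q (G y) hq hq2 (fun J => auxR σ (h (insert n J)) y) (hfD y)
    have a2 := aux_avg n q (G y) hq hq2 (fun J => auxR σ (h (insert n J)) y) (hfD y)
    refine ⟨?_, ?_, ?_⟩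
    · rw [hD]
      exact Finset.sum_nonneg fun i _ => mul_nonneg (hw0 i) (auxR_pos _ _ _).le
    · rw [hD, hw]; exact a1.2
    · rw [hD, hw, hK]; simpa using a2
  have hB0 : ∀ y, 0 < B y := fun y => hc0.trans_le (hBb y).1
  have hA0 : ∀ y, 0 < (1 - q) * B y + q * D y := fun y =>
    add_pos_of_pos_of_nonneg (mul_pos (by linarith) (hB0 y)) (mul_nonneg hq.le (hDb y).1)
  have hQ : subsampledQ n σ q h = ν.withDensity fun y => ENNReal.ofReal (B y) := by
    rw [hB]
    rw [← aux_mix σ hσ _ w h hw0, hw]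
    rfl
  have hP : subsampledP n σ q h
      = ν.withDensity fun y => ENNReal.ofReal ((1 - q) * B y + q * D y) := by
    rw [subsampledP, aux_mix σ hσ _ (fun J => q ^ J.card * (1 - q) ^ (n + 1 - J.card)) h
      (fun J => mul_nonneg (pow_nonneg hq.le _) (pow_nonneg (by linarith) _))]
    congr 1
    ext y
    congr 1
    rw [Finset.range_add_one, Finset.sum_powerset_insert Finset.notMem_range_self, hB, hD, hw,
      Finset.mul_sum, Finset.mul_sum]
    congr 1
    · refine Finset.sum_congr rfl fun J hJ => ?_
      have hcard : J.card ≤ n := by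
        simpa using Finset.card_le_card (Finset.mem_powerset.1 hJ)
      rw [Nat.sub_add_comm hcard, pow_succ]
      ring
    · refine Finset.sum_congr rfl fun J hJ => ?_
      have hnJ : n ∉ J := fun hn => Finset.notMem_range_self (Finset.mem_powerset.1 hJ hn)
      rw [Finset.card_insert_of_notMem hnJ, Nat.add_sub_add_right, pow_succ]
      ring
  obtain ⟨hLP, hLQ⟩ := aux_loss ν (subsampledP n σ q h) (subsampledQ n σ q h)
    (fun y => (1 - q) * B y + q * D y) B (by fun_prop) hBm hA0 hB0 hP hQ
  have hpt := fun y => aux_pt q c K (G y) (B y) (D y) (auxR σ (h {n}) y) hq hq2 hc0 hK0 (hG1 y)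
    (hBb y).1 (hBb y).2.1 (hDb y).1 (hDb y).2.1 (auxR_pos _ _ _).le
    (hGR y _ (by simp)) (hBb y).2.2 (hDb y).2.2
  rw [← hM] at hpt
  have hHi : Integrable (fun y => M * q ^ 3 * G y ^ 5) ν := hGint.const_mul _
  have hi1 : Integrable (fun y => q * (D y - B y)) ν := (hDi.sub hBi).const_mul _
  have hi2 : Integrable (fun y => q ^ 2 / 2 * (auxR σ (h {n}) y - 1) ^ 2) ν :=
    (auxR_sub_sq_integrable σ _).const_mul _
  have hv1 : ∫ y, q * (D y - B y) ∂ν = 0 := by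
    rw [integral_const_mul, integral_sub hDi hBi, hB1, hD1]; simp
  have hv2 : ∫ y, q ^ 2 / 2 * (auxR σ (h {n}) y - 1) ^ 2 ∂ν
      = q ^ 2 / 2 * (Real.exp ((h {n}) ^ 2 / σ ^ 2) - 1) := by
    rw [integral_const_mul, auxR_sub_sq_integral σ _ hσ]
  have hfin : ∫ y, M * q ^ 3 * G y ^ 5 ∂ν ≤ (M * (∫ y, G y ^ 5 ∂ν) + 1) * q ^ 3 := by
    rw [integral_const_mul]
    have : 0 < q ^ 3 := by positivity
    nlinarith
  have hlm : Measurable fun y => Real.log (((1 - q) * B y + q * D y) / B y) := by fun_prop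
  have b1 := aux_intbound ν
    (fun y => ((1 - q) * B y + q * D y) * Real.log (((1 - q) * B y + q * D y) / B y)) _ _
    (by fun_prop) (hi1.add hi2) hHi (fun y => (hpt y).2)
  have b2 := aux_intbound ν
    (fun y => B y * Real.log (((1 - q) * B y + q * D y) / B y)) _ _
    (by fun_prop) (hi1.sub hi2) hHi (fun y => (hpt y).1)
  simp only [Pi.add_apply, Pi.sub_apply] at b1 b2
  rw [integral_add hi1 hi2, hv1, hv2] at b1
  rw [integral_sub hi1 hi2, hv1, hv2] at b2
  unfold privacyLoss
  rw [hLP, hLQ]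
  constructor
  · refine le_trans (le_of_eq ?_) (b1.trans hfin)
    congr 1
    ring
  · refine le_trans (le_of_eq ?_) (b2.trans hfin)
    congr 1
    ring
end

section
/- There exist constants C > 0 and q₀ ∈ (0,1), depending on n, σ and h, such that for all q ∈ (0, q₀]: |Var_{P_q}[L_q] − q²·(e^{μ²/σ²} − 1)| ≤ C·q³ and |Var_{Q_q}[L_q] − q²·(e^{μ²/σ²} − 1)| ≤ C·q³. That is, as q → 0, the variance of the privacy loss of the Poisson-subsampled Gaussian mechanism under each of P and Q is q²(e^{μ²/σ²} − 1) + O(q³). -/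
open MeasureTheory ProbabilityTheory

/-- The variance `Var_μ[f] = E_μ[f²] − (E_μ[f])²` of a function against a measure. -/
noncomputable def varAgainst (μ : Measure ℝ) (f : ℝ → ℝ) : ℝ :=
  (∫ y, f y ^ 2 ∂μ) - (∫ y, f y ∂μ) ^ 2

noncomputable def sgE (σ m y : ℝ) : ℝ := Real.exp (m * y / σ ^ 2 - m ^ 2 / (2 * σ ^ 2))

noncomputable def sgMix (m : ℕ) (q : ℝ) (f : Finset ℕ → ℝ) : ℝ :=
  ∑ J ∈ (Finset.range m).powerset, q ^ J.card * (1 - q) ^ (m - J.card) * f J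

lemma sgMix_succ (n : ℕ) (q : ℝ) (f : Finset ℕ → ℝ) :
    sgMix (n + 1) q f = (1 - q) * sgMix n q f + q * sgMix n q (fun J => f (insert n J)) := by
  unfold sgMix
  rw [Finset.range_add_one, Finset.sum_powerset_insert (by simp), Finset.mul_sum, Finset.mul_sum]
  congr 1
  · refine Finset.sum_congr rfl fun J hJ => ?_
    have : J.card ≤ n := by simpa using Finset.card_le_card (Finset.mem_powerset.1 hJ)
    rw [show n + 1 - J.card = (n - J.card) + 1 by omega]; ring
  · refine Finset.sum_congr rfl fun J hJ => ?_
    have hn : n ∉ J := fun hh => by simpa using Finset.mem_powerset.1 hJ hh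
    rw [Finset.card_insert_of_notMem hn, show n + 1 - (J.card + 1) = n - J.card by omega]; ring

lemma sgMix_bound (m : ℕ) (q : ℝ) (f : Finset ℕ → ℝ) (F : ℝ) (hq : 0 < q) (hq1 : q ≤ 1)
    (hf : ∀ J, 0 ≤ f J) (hF : ∑ J ∈ (Finset.range m).powerset, f J ≤ F) :
    |sgMix m q f - f ∅| ≤ (m + 1) * q * F := by
  have hmem : ∅ ∈ (Finset.range m).powerset := by simp
  have hq1' : 0 ≤ 1 - q := by linarith
  have h0F : f ∅ ≤ F := (Finset.single_le_sum (fun J _ => hf J) hmem).trans hF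
  unfold sgMix
  rw [← Finset.add_sum_erase _ _ hmem]
  have hb : 1 + (m : ℝ) * (-q) ≤ (1 + (-q)) ^ m :=
    one_add_mul_le_pow (by linarith) m
  have hb2 : (1 - q) ^ m ≤ 1 := pow_le_one₀ hq1' (by linarith)
  have hs0 : 0 ≤ ∑ J ∈ (Finset.range m).powerset.erase ∅,
      q ^ J.card * (1 - q) ^ (m - J.card) * f J :=
    Finset.sum_nonneg fun J _ => by have := hf J; positivity
  have hs1 : ∑ J ∈ (Finset.range m).powerset.erase ∅,
      q ^ J.card * (1 - q) ^ (m - J.card) * f J ≤ q * F := by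
    calc _ ≤ ∑ J ∈ (Finset.range m).powerset.erase ∅, q * f J := by
          refine Finset.sum_le_sum fun J hJ => ?_
          have hJ' : J.card ≠ 0 := by simpa using (Finset.mem_erase.1 hJ).1
          have h1 : q ^ J.card ≤ q := pow_le_of_le_one hq.le hq1 hJ'
          have h2 : (1 - q) ^ (m - J.card) ≤ 1 := pow_le_one₀ hq1' (by linarith)
          have h3 : q ^ J.card * (1 - q) ^ (m - J.card) ≤ q * 1 :=
            mul_le_mul h1 h2 (by positivity) hq.le
          have := hf J
          nlinarith
      _ = q * ∑ J ∈ (Finset.range m).powerset.erase ∅, f J := by rw [Finset.mul_sum]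
      _ ≤ q * F := by
          gcongr
          exact (Finset.sum_le_sum_of_subset_of_nonneg (Finset.erase_subset _ _)
            (fun J _ _ => hf J)).trans hF
  simp only [Finset.card_empty, pow_zero, one_mul, Nat.sub_zero]
  have hfe := hf ∅
  have e1 : (1 - q) ^ m * f ∅ ≤ f ∅ := by nlinarith
  have e2 : f ∅ - m * q * F ≤ (1 - q) ^ m * f ∅ := by
    have : (1 + (-q)) = 1 - q := by ring
    rw [this] at hb
    have a1 : (m:ℝ) * q * f ∅ ≤ m * q * F := by gcongr
    nlinarith
  have : 0 ≤ (m:ℝ) * q * F := mul_nonneg (by positivity) (hfe.trans h0F)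
  rw [abs_le]; constructor <;> nlinarith

lemma sgMix_lower (m : ℕ) (q : ℝ) (f : Finset ℕ → ℝ) (hq : 0 < q) (hq1 : q ≤ 1 / 2)
    (hf : ∀ J, 0 ≤ f J) (h0 : f ∅ = 1) : 1 ≤ 2 ^ m * sgMix m q f := by
  have hmem : ∅ ∈ (Finset.range m).powerset := by simp
  have hq1' : 0 ≤ 1 - q := by linarith
  have : (1 - q) ^ m ≤ sgMix m q f := by
    have := Finset.single_le_sum (f := fun J : Finset ℕ => q ^ J.card * (1 - q) ^ (m - J.card) * f J)
      (fun J _ => by have := hf J; positivity) hmem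
    simpa [h0, sgMix] using this
  calc (1:ℝ) = 1 ^ m := by simp
    _ ≤ (2 * (1 - q)) ^ m := by gcongr; linarith
    _ = 2 ^ m * (1 - q) ^ m := mul_pow _ _ _
    _ ≤ _ := by gcongr

lemma sgMix_nonneg (m : ℕ) (q : ℝ) (f : Finset ℕ → ℝ) (hq : 0 < q) (hq1 : q ≤ 1)
    (hf : ∀ J, 0 ≤ f J) : 0 ≤ sgMix m q f := by
  have hq1' : 0 ≤ 1 - q := by linarith
  exact Finset.sum_nonneg fun J _ => by have := hf J; positivity

lemma sgMix_upper (m : ℕ) (q : ℝ) (f : Finset ℕ → ℝ) (hq : 0 < q) (hq1 : q ≤ 1)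
    (hf : ∀ J, 0 ≤ f J) : sgMix m q f ≤ ∑ J ∈ (Finset.range m).powerset, f J := by
  have hq1' : 0 ≤ 1 - q := by linarith
  refine Finset.sum_le_sum fun J _ => ?_
  have h1 : q ^ J.card ≤ 1 := pow_le_one₀ hq.le hq1
  have h2 : (1 - q) ^ (m - J.card) ≤ 1 := pow_le_one₀ hq1' (by linarith)
  have h3 : q ^ J.card * (1 - q) ^ (m - J.card) ≤ 1 * 1 :=
    mul_le_mul h1 h2 (by positivity) (by norm_num)
  have := hf J
  nlinarith

lemma sg_log_bound (u : ℝ) (hu : -(1 / 2) ≤ u) : |Real.log (1 + u) - u| ≤ 2 * u ^ 2 := by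
  have hp : 0 < 1 + u := by linarith
  have h1 := Real.log_le_sub_one_of_pos hp
  have h2 := Real.one_sub_inv_le_log_of_pos hp
  have h3 : u - 2 * u ^ 2 ≤ 1 - (1 + u)⁻¹ := by
    have : 1 - (1 + u)⁻¹ - (u - 2 * u ^ 2) = u ^ 2 * (1 + 2 * u) / (1 + u) := by
      field_simp; ring
    have h4 : 0 ≤ u ^ 2 * (1 + 2 * u) / (1 + u) :=
      div_nonneg (mul_nonneg (sq_nonneg _) (by linarith)) hp.le
    linarith
  rw [abs_le]; constructor <;> nlinarith [sq_nonneg u]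

set_option maxHeartbeats 1000000 in
/-- pointwise bound of the loss -/
lemma sg_point (n : ℕ) (q : ℝ) (f : Finset ℕ → ℝ) (hq : 0 < q) (hq1 : q ≤ 1 / 2)
    (hf : ∀ J, 0 ≤ f J) (h0 : f ∅ = 1) (E K : ℝ)
    (hE : E = ∑ J ∈ (Finset.range (n + 1)).powerset, f J)
    (hK : K = (16 * 4 ^ n * (n + 2)) * E ^ 2) :
    |sgMix n q f - 1| ≤ q * K ∧ |sgMix (n + 1) q f - 1| ≤ q * K ∧ |f {n} - 1| ≤ K ∧ 1 ≤ K ∧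
      |Real.log (sgMix (n + 1) q f / sgMix n q f) - q * (f {n} - 1)| ≤ q ^ 2 * K := by
  set a : ℝ := 2 ^ n with ha
  have ha1 : 1 ≤ a := one_le_pow₀ (by norm_num)
  have h4 : (4:ℝ) ^ n = a ^ 2 := by rw [ha, ← pow_mul, mul_comm, pow_mul]; norm_num
  rw [h4] at hK
  have hN : (0:ℝ) ≤ n := Nat.cast_nonneg n
  set N : ℝ := (n : ℝ)
  have hsplit : E = ∑ J ∈ (Finset.range n).powerset, f J
      + ∑ J ∈ (Finset.range n).powerset, f (insert n J) := by
    rw [hE, Finset.range_add_one, Finset.sum_powerset_insert (by simp)]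
  have hs1 : 0 ≤ ∑ J ∈ (Finset.range n).powerset, f J := Finset.sum_nonneg fun J _ => hf J
  have hs2 : 0 ≤ ∑ J ∈ (Finset.range n).powerset, f (insert n J) :=
    Finset.sum_nonneg fun J _ => hf _
  have hE1 : 1 ≤ E := by
    rw [hE, ← h0]; exact Finset.single_le_sum (fun J _ => hf J) (by simp)
  have hfn : f {n} ≤ E := by
    rw [hE]; exact Finset.single_le_sum (fun J _ => hf J) (by simp)
  have hfn0 := hf {n}
  have bQ : |sgMix n q f - 1| ≤ (N + 1) * q * E := by
    simpa [h0] using sgMix_bound n q f E hq (by linarith) hf (by linarith)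
  have bP : |sgMix (n + 1) q f - 1| ≤ (N + 2) * q * E := by
    have := sgMix_bound (n + 1) q f E hq (by linarith) hf hE.ge
    rw [h0] at this
    refine this.trans (le_of_eq ?_); push_cast; ring
  have bR : |sgMix n q (fun J => f (insert n J)) - f {n}| ≤ (N + 1) * q * E := by
    simpa using sgMix_bound n q (fun J => f (insert n J)) E hq (by linarith) (fun _ => hf _)
      (by linarith)
  have lQ := sgMix_lower n q f hq hq1 hf h0
  have nR := sgMix_nonneg n q (fun J => f (insert n J)) hq (by linarith) (fun _ => hf _)
  have uR : sgMix n q (fun J => f (insert n J)) ≤ E := by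
    have := sgMix_upper n q (fun J => f (insert n J)) hq (by linarith) (fun _ => hf _)
    linarith
  rw [sgMix_succ] at bP ⊢
  set Q := sgMix n q f
  set R := sgMix n q (fun J => f (insert n J))
  have hEE : E ≤ E ^ 2 := by nlinarith
  have haa : 1 ≤ a ^ 2 := by nlinarith
  have ha2 : a ≤ a ^ 2 := by nlinarith
  have hK2 : (N + 2) * E ≤ K := by
    rw [hK]
    calc (N + 2) * E ≤ (N + 2) * E ^ 2 := by gcongr
      _ = (1 * 1 * (N + 2)) * E ^ 2 := by ring
      _ ≤ _ := by gcongr; norm_num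
  have hQ : 0 < Q := by
    by_contra hh
    have : a * Q ≤ 0 := mul_nonpos_of_nonneg_of_nonpos (by linarith) (by linarith)
    linarith
  have hinv : 1 / Q ≤ a := by rw [div_le_iff₀ hQ]; exact lQ
  refine ⟨?_, ?_, ?_, ?_, ?_⟩
  · refine bQ.trans ?_
    have : q * ((N + 2) * E) ≤ q * K := by gcongr
    nlinarith [mul_pos hq (by linarith : 0 < E)]
  · refine bP.trans ?_
    have : q * ((N + 2) * E) ≤ q * K := by gcongr
    linarith
  · rw [abs_le]; constructor <;> nlinarith
  · nlinarith
  · have hX : ((1 - q) * Q + q * R) / Q = 1 + q * (R / Q - 1) := by field_simp; ring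
    rw [hX]
    set X := R / Q - 1 with hXd
    have hRQ : 0 ≤ R / Q := div_nonneg nR hQ.le
    have hRQ2 : R / Q ≤ a * E := by
      calc R / Q = (1 / Q) * R := by ring
        _ ≤ a * E := by gcongr
    have haE : 1 ≤ a * E := by nlinarith
    have hX2 : X ^ 2 ≤ a ^ 2 * E ^ 2 := by
      rw [← mul_pow, sq_le_sq, abs_of_nonneg (by linarith : 0 ≤ a * E), abs_le]
      constructor <;> linarith
    have hX1 : -1 ≤ X := by linarith
    have hqX : q * (-1) ≤ q * X := mul_le_mul_of_nonneg_left hX1 hq.le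
    have l1 := sg_log_bound (q * X) (by linarith)
    have hXD : |X - (f {n} - 1)| ≤ a * (2 * (N + 1) * q * E ^ 2) := by
      have e : X - (f {n} - 1) = (1 / Q) * ((R - f {n}) - f {n} * (Q - 1)) := by
        rw [hXd]; field_simp; ring
      rw [e, abs_mul, abs_of_pos (by positivity : 0 < 1 / Q)]
      refine mul_le_mul hinv ?_ (abs_nonneg _) (by linarith)
      calc _ ≤ |R - f {n}| + |f {n} * (Q - 1)| := abs_sub _ _
        _ ≤ (N + 1) * q * E + E * ((N + 1) * q * E) := by
            rw [abs_mul, abs_of_nonneg hfn0]; gcongr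
        _ ≤ (N + 1) * q * E ^ 2 + E * ((N + 1) * q * E) := by gcongr
        _ = _ := by ring
    calc |Real.log (1 + q * X) - q * (f {n} - 1)|
        = |(Real.log (1 + q * X) - q * X) + q * (X - (f {n} - 1))| := by congr 1; ring
      _ ≤ |Real.log (1 + q * X) - q * X| + |q * (X - (f {n} - 1))| := abs_add_le _ _
      _ ≤ 2 * (q * X) ^ 2 + q * (a * (2 * (N + 1) * q * E ^ 2)) := by
          rw [abs_mul, abs_of_pos hq]; gcongr
      _ = q ^ 2 * (2 * X ^ 2 + a * (2 * (N + 1) * E ^ 2)) := by ring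
      _ ≤ q ^ 2 * (2 * (a ^ 2 * E ^ 2) + a ^ 2 * (2 * (N + 1) * E ^ 2)) := by gcongr
      _ = q ^ 2 * ((2 * a ^ 2 * (N + 2)) * E ^ 2) := by ring
      _ ≤ q ^ 2 * K := by
          rw [hK]
          refine mul_le_mul_of_nonneg_left (mul_le_mul_of_nonneg_right ?_ (sq_nonneg _)) (sq_nonneg _)
          have : 0 ≤ a ^ 2 * (N + 2) := by positivity
          linarith

lemma sg_var_bound (γ : Measure ℝ) [IsProbabilityMeasure γ] (K D ρ L : ℝ → ℝ) (q V : ℝ)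
    (hq : 0 < q) (hq1 : q ≤ 1)
    (hK : ∀ y, 1 ≤ K y) (hK3 : Integrable (fun y => K y ^ 3) γ)
    (hDm : Measurable D) (hρm : Measurable ρ) (hLm : Measurable L)
    (hD : ∀ y, |D y| ≤ K y) (hρ : ∀ y, |ρ y - 1| ≤ q * K y)
    (hL : ∀ y, |L y - q * D y| ≤ q ^ 2 * K y)
    (hD0 : ∫ y, D y ∂γ = 0) (hD2 : ∫ y, D y ^ 2 ∂γ = V) :
    |(∫ y, ρ y * L y ^ 2 ∂γ) - (∫ y, ρ y * L y ∂γ) ^ 2 - q ^ 2 * V| ≤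
      (7 * (∫ y, K y ^ 3 ∂γ) + 9 * (∫ y, K y ^ 3 ∂γ) ^ 2) * q ^ 3 := by
  set M := ∫ y, K y ^ 3 ∂γ with hM
  have hK13 : ∀ y, K y ≤ K y ^ 3 := fun y => le_self_pow₀ (hK y) (by norm_num)
  have hK23 : ∀ y, K y ^ 2 ≤ K y ^ 3 := fun y => pow_le_pow_right₀ (hK y) (by norm_num)
  have iD : Integrable D γ := hK3.mono' hDm.aestronglyMeasurable
    (Filter.Eventually.of_forall fun y => (hD y).trans (hK13 y))
  have iD2 : Integrable (fun y => D y ^ 2) γ := hK3.mono' (hDm.pow_const 2).aestronglyMeasurable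
    (Filter.Eventually.of_forall fun y => by
      rw [Real.norm_eq_abs, abs_pow]
      exact (pow_le_pow_left₀ (abs_nonneg _) (hD y) 2).trans (hK23 y))
  have bL : ∀ y, |L y| ≤ 2 * q * K y := fun y => by
    have h1 : |L y| ≤ |L y - q * D y| + |q * D y| := by
      simpa using abs_add_le (L y - q * D y) (q * D y)
    rw [abs_mul, abs_of_pos hq] at h1
    have h2 : q * |D y| ≤ q * K y := by gcongr; exact hD y
    have h3 : q ^ 2 * K y ≤ q * K y := by
      have := hK y
      gcongr; nlinarith
    linarith [hL y]
  have p1 : ∀ y, |ρ y * L y - q * D y| ≤ 3 * q ^ 2 * K y ^ 3 := fun y => by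
    have hk := hK y
    calc _ = |(ρ y - 1) * L y + (L y - q * D y)| := by congr 1; ring
      _ ≤ |ρ y - 1| * |L y| + |L y - q * D y| := by
        rw [← abs_mul]; exact abs_add_le _ _
      _ ≤ (q * K y) * (2 * q * K y) + q ^ 2 * K y := by
        gcongr
        · exact hρ y
        · exact bL y
        · exact hL y
      _ = q ^ 2 * (2 * K y ^ 2 + K y) := by ring
      _ ≤ q ^ 2 * (2 * K y ^ 3 + K y ^ 3) := by
        have := hK23 y
        have := hK13 y
        exact mul_le_mul_of_nonneg_left (by linarith) (by positivity)
      _ = _ := by ring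
  have p2 : ∀ y, |ρ y * L y ^ 2 - q ^ 2 * D y ^ 2| ≤ 7 * q ^ 3 * K y ^ 3 := fun y => by
    have hk := hK y
    calc _ = |(ρ y - 1) * (L y * L y) + (L y - q * D y) * (L y + q * D y)| := by congr 1; ring
      _ ≤ |ρ y - 1| * (|L y| * |L y|) + |L y - q * D y| * (|L y| + q * |D y|) := by
        refine (abs_add_le _ _).trans ?_
        rw [abs_mul, abs_mul, abs_mul]
        gcongr
        refine (abs_add_le _ _).trans ?_
        rw [abs_mul, abs_of_pos hq]
      _ ≤ (q * K y) * ((2 * q * K y) * (2 * q * K y)) +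
          q ^ 2 * K y * (2 * q * K y + q * K y) := by
        gcongr
        · exact hρ y
        · exact bL y
        · exact bL y
        · exact hL y
        · exact bL y
        · exact hD y
      _ = q ^ 3 * (4 * K y ^ 3 + 3 * K y ^ 2) := by ring
      _ ≤ q ^ 3 * (4 * K y ^ 3 + 3 * K y ^ 3) := by
        have := hK23 y
        exact mul_le_mul_of_nonneg_left (by linarith) (by positivity)
      _ = _ := by ring
  have i1 : Integrable (fun y => ρ y * L y - q * D y) γ :=
    (hK3.const_mul (3 * q ^ 2)).mono' (by fun_prop) (Filter.Eventually.of_forall p1)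
  have i2 : Integrable (fun y => ρ y * L y ^ 2 - q ^ 2 * D y ^ 2) γ :=
    (hK3.const_mul (7 * q ^ 3)).mono' (by fun_prop) (Filter.Eventually.of_forall p2)
  have r1 : |∫ y, ρ y * L y ∂γ| ≤ 3 * q ^ 2 * M := by
    have e : ∫ y, ρ y * L y ∂γ = ∫ y, (ρ y * L y - q * D y) ∂γ := by
      have := integral_add i1 (iD.const_mul q)
      rw [integral_const_mul, hD0] at this
      simpa using this
    rw [e, hM, ← integral_const_mul, ← Real.norm_eq_abs]
    exact norm_integral_le_of_norm_le (hK3.const_mul (3 * q ^ 2)) (Filter.Eventually.of_forall p1)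
  have r2 : |(∫ y, ρ y * L y ^ 2 ∂γ) - q ^ 2 * V| ≤ 7 * q ^ 3 * M := by
    have e : (∫ y, ρ y * L y ^ 2 ∂γ) - q ^ 2 * V
        = ∫ y, (ρ y * L y ^ 2 - q ^ 2 * D y ^ 2) ∂γ := by
      have := integral_add i2 (iD2.const_mul (q ^ 2))
      rw [integral_const_mul, hD2] at this
      simp only [sub_add_cancel] at this
      rw [this]; ring
    rw [e, hM, ← integral_const_mul, ← Real.norm_eq_abs]
    exact norm_integral_le_of_norm_le (hK3.const_mul (7 * q ^ 3)) (Filter.Eventually.of_forall p2)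
  have r3 : (∫ y, ρ y * L y ∂γ) ^ 2 ≤ 9 * M ^ 2 * q ^ 3 := by
    rw [← sq_abs]
    calc _ ≤ (3 * q ^ 2 * M) ^ 2 := by gcongr
      _ = 9 * M ^ 2 * (q ^ 3 * q) := by ring
      _ ≤ 9 * M ^ 2 * (q ^ 3 * 1) := by gcongr
      _ = _ := by ring
  have := sq_nonneg (∫ y, ρ y * L y ∂γ)
  rw [abs_le] at r2 ⊢
  have : 0 ≤ 9 * M ^ 2 * q ^ 3 := by positivity
  constructor <;> nlinarith

lemma sg_gauss (σ : ℝ) (hσ : 0 < σ) (m : ℝ) :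
    gaussianReal m (σ ^ 2).toNNReal =
      (gaussianReal 0 (σ ^ 2).toNNReal).withDensity (fun y => ENNReal.ofReal (sgE σ m y)) := by
  have hv : (σ ^ 2).toNNReal ≠ 0 := by simp; positivity
  rw [gaussianReal_of_var_ne_zero _ hv, gaussianReal_of_var_ne_zero _ hv,
    ← withDensity_mul _ (measurable_gaussianPDF _ _) (by unfold sgE; fun_prop)]
  congr 1
  ext y
  simp only [Pi.mul_apply, gaussianPDF]
  rw [← ENNReal.ofReal_mul (gaussianPDFReal_nonneg _ _ _)]
  congr 1
  simp only [gaussianPDFReal, sgE]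
  rw [mul_assoc (√_)⁻¹, ← Real.exp_add, Real.coe_toNNReal _ (by positivity)]
  congr 2
  field_simp
  ring

lemma sg_measure (m : ℕ) (σ q : ℝ) (h : Finset ℕ → ℝ) (hσ : 0 < σ) (hq : 0 < q) (hq1 : q ≤ 1) :
    (∑ J ∈ (Finset.range m).powerset,
    ENNReal.ofReal (q ^ J.card * (1 - q) ^ (m - J.card)) •
      gaussianReal (h J) (σ ^ 2).toNNReal) =
    (gaussianReal 0 (σ ^ 2).toNNReal).withDensity
      (fun y => ENNReal.ofReal (sgMix m q (fun J => sgE σ (h J) y))) := by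
  have hq1' : 0 ≤ 1 - q := by linarith
  have hm : ∀ J, Measurable (fun y => ENNReal.ofReal (sgE σ (h J) y)) := fun J => by
    unfold sgE; fun_prop
  ext s hs
  rw [withDensity_apply _ hs, Measure.finsetSum_apply]
  simp only [sgMix]
  have hsum : ∀ y, ENNReal.ofReal (∑ J ∈ (Finset.range m).powerset,
      q ^ J.card * (1 - q) ^ (m - J.card) * sgE σ (h J) y) =
      ∑ J ∈ (Finset.range m).powerset,
        ENNReal.ofReal (q ^ J.card * (1 - q) ^ (m - J.card) * sgE σ (h J) y) := fun y =>
    ENNReal.ofReal_sum_of_nonneg (fun J _ => by unfold sgE; positivity)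
  simp_rw [hsum]
  rw [lintegral_finsetSum _ (fun J _ => by unfold sgE; fun_prop)]
  refine Finset.sum_congr rfl fun J _ => ?_
  simp_rw [ENNReal.ofReal_mul (show 0 ≤ q ^ (Finset.card J) *
    (1 - q) ^ (m - Finset.card J) by positivity)]
  rw [lintegral_const_mul _ (hm J), sg_gauss σ hσ (h J), Measure.smul_apply,
    withDensity_apply _ hs, smul_eq_mul]

lemma sg_int_exp (v : NNReal) (t : ℝ) :
    ∫ y, Real.exp (t * y) ∂(gaussianReal 0 v) = Real.exp (v * t ^ 2 / 2) := by
  have := congrFun (mgf_id_gaussianReal (μ := 0) (v := v)) t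
  simpa [mgf] using this

lemma sgE_eq (σ m y : ℝ) : sgE σ m y =
    Real.exp (-(m ^ 2 / (2 * σ ^ 2))) * Real.exp ((m / σ ^ 2) * y) := by
  rw [sgE, ← Real.exp_add]; congr 1; ring

lemma sgE_pow (σ m y : ℝ) (k : ℕ) : sgE σ m y ^ k =
    Real.exp (-(m ^ 2 / (2 * σ ^ 2)) * k) * Real.exp ((k * (m / σ ^ 2)) * y) := by
  rw [sgE, ← Real.exp_add, ← Real.exp_nat_mul]; congr 1; ring

lemma sgE_int_pow (σ m : ℝ) (v : NNReal) (k : ℕ) :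
    Integrable (fun y => sgE σ m y ^ k) (gaussianReal 0 v) := by
  simp_rw [sgE_pow]
  exact (integrable_exp_mul_gaussianReal _).const_mul _

lemma sgE_int_one (σ m : ℝ) (hσ : 0 < σ) :
    ∫ y, sgE σ m y ∂(gaussianReal 0 (σ ^ 2).toNNReal) = 1 := by
  simp_rw [sgE_eq]
  rw [integral_const_mul, sg_int_exp, Real.coe_toNNReal _ (by positivity), ← Real.exp_add,
    Real.exp_eq_one_iff]
  field_simp
  ring

lemma sgE_int_two (σ m : ℝ) (hσ : 0 < σ) :
    ∫ y, sgE σ m y ^ 2 ∂(gaussianReal 0 (σ ^ 2).toNNReal) = Real.exp (m ^ 2 / σ ^ 2) := by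
  simp_rw [sgE_pow]
  rw [integral_const_mul, sg_int_exp, Real.coe_toNNReal _ (by positivity), ← Real.exp_add]
  congr 1
  push_cast
  field_simp
  ring

lemma sgE_memLp (σ m : ℝ) (v : NNReal) (k : ℕ) (hk : k ≠ 0) :
    MemLp (fun y => sgE σ m y) k (gaussianReal 0 v) := by
  rw [← integrable_norm_rpow_iff (by unfold sgE; fun_prop) (by simpa using hk) (by simp)]
  have := sgE_int_pow σ m v k
  refine this.congr (Filter.Eventually.of_forall fun y => ?_)
  simp [abs_of_pos (show 0 < sgE σ m y from Real.exp_pos _)]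

lemma sgE_sum_int (σ : ℝ) (h : Finset ℕ → ℝ) (v : NNReal) (s : Finset (Finset ℕ)) :
    Integrable (fun y => (∑ J ∈ s, sgE σ (h J) y) ^ 6) (gaussianReal 0 v) := by
  have h1 : MemLp (fun y => ∑ J ∈ s, sgE σ (h J) y) (6 : ℕ) (gaussianReal 0 v) :=
    memLp_finsetSum s fun J _ => sgE_memLp σ (h J) v 6 (by norm_num)
  have := h1.integrable_norm_pow (by norm_num)
  refine this.congr (Filter.Eventually.of_forall fun y => ?_)
  simp only [Real.norm_eq_abs]
  exact Even.pow_abs (by decide) _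

lemma sg_integral_density (γ : Measure ℝ) (ρ g : ℝ → ℝ) (hρ : Measurable ρ) (h0 : ∀ y, 0 ≤ ρ y) :
    ∫ y, g y ∂(γ.withDensity fun y => ENNReal.ofReal (ρ y)) = ∫ y, ρ y * g y ∂γ := by
  rw [integral_withDensity_eq_integral_toReal_smul (by fun_prop) (by simp)]
  simp [h0]

lemma sg_rnDeriv (γ : Measure ℝ) [IsProbabilityMeasure γ] (ρ τ : ℝ → ℝ) (hρ : Measurable ρ)
    (hτ : Measurable τ) (h0 : ∀ y, 0 ≤ ρ y) (h1 : ∀ y, 0 < τ y) :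
    ∀ᵐ y ∂γ, (((γ.withDensity fun y => ENNReal.ofReal (ρ y)).rnDeriv
      (γ.withDensity fun y => ENNReal.ofReal (τ y)) y).toReal) = ρ y / τ y := by
  have e : (γ.withDensity fun y => ENNReal.ofReal (ρ y)) =
      (γ.withDensity fun y => ENNReal.ofReal (τ y)).withDensity
        (fun y => ENNReal.ofReal (ρ y / τ y)) := by
    rw [← withDensity_mul _ (by fun_prop) (by fun_prop)]
    congr 1
    ext y
    rw [Pi.mul_apply, ← ENNReal.ofReal_mul (h1 y).le, mul_div_cancel₀ _ (h1 y).ne']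
  have ac : γ ≪ γ.withDensity fun y => ENNReal.ofReal (τ y) :=
    withDensity_absolutelyContinuous' (by fun_prop)
      (Filter.Eventually.of_forall fun y => by simpa using h1 y)
  have : SigmaFinite (γ.withDensity fun y => ENNReal.ofReal (τ y)) :=
    SigmaFinite.withDensity_ofReal _
  rw [e]
  have := Measure.rnDeriv_withDensity (γ.withDensity fun y => ENNReal.ofReal (τ y))
    (f := fun y => ENNReal.ofReal (ρ y / τ y)) (by fun_prop)
  filter_upwards [ac.ae_le this] with y hy
  rw [hy, ENNReal.toReal_ofReal (div_nonneg (h0 y) (h1 y).le)]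

/-- **Small sampling-rate approximation of the variance of the privacy loss of the
Poisson-subsampled Gaussian mechanism.**  With `μ = |h {n}|`, as `q → 0`:
`Var_{P_q}[L_q] = q² (e^{μ²/σ²} − 1) + O(q³)` and likewise under `Q_q`. -/
theorem subsampledGaussian_var_privacyLoss_small_q
    (n : ℕ) (σ : ℝ) (hσ : 0 < σ) (h : Finset ℕ → ℝ) (h0 : h ∅ = 0) :
    ∃ C > (0 : ℝ), ∃ q₀ ∈ Set.Ioo (0 : ℝ) 1, ∀ q ∈ Set.Ioc (0 : ℝ) q₀,
      |varAgainst (subsampledP n σ q h) (privacyLoss n σ q h) -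
          q ^ 2 * (Real.exp ((h {n}) ^ 2 / σ ^ 2) - 1)| ≤ C * q ^ 3 ∧
      |varAgainst (subsampledQ n σ q h) (privacyLoss n σ q h) -
          q ^ 2 * (Real.exp ((h {n}) ^ 2 / σ ^ 2) - 1)| ≤ C * q ^ 3 := by
  classical
  set γ := gaussianReal 0 (σ ^ 2).toNNReal with hγ
  set E : ℝ → ℝ := fun y => ∑ J ∈ (Finset.range (n + 1)).powerset, sgE σ (h J) y with hE
  set K : ℝ → ℝ := fun y => (16 * 4 ^ n * (n + 2)) * E y ^ 2 with hK
  set D : ℝ → ℝ := fun y => sgE σ (h {n}) y - 1 with hD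
  have hpos : ∀ y J, 0 ≤ sgE σ (h J) y := fun y J => (Real.exp_pos _).le
  have he0 : ∀ y, sgE σ (h ∅) y = 1 := fun y => by simp [sgE, h0]
  have hEm : ∀ m, Measurable (sgE σ m) := fun m => by unfold sgE; fun_prop
  have hMm : ∀ m q, Measurable (fun y => sgMix m q (fun J => sgE σ (h J) y)) := fun m q => by
    unfold sgMix
    exact Finset.measurable_fun_sum _ fun J _ => (hEm _).const_mul _
  have hK3 : Integrable (fun y => K y ^ 3) γ := by
    have := (sgE_sum_int σ h (σ ^ 2).toNNReal (Finset.range (n + 1)).powerset).const_mul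
      ((16 * 4 ^ n * ((n:ℝ) + 2)) ^ 3)
    refine this.congr (Filter.Eventually.of_forall fun y => ?_)
    simp only [hK, hE]; ring
  have i1 : Integrable (sgE σ (h {n})) γ := by
    simpa using sgE_int_pow σ (h {n}) (σ ^ 2).toNNReal 1
  have i2 := sgE_int_pow σ (h {n}) (σ ^ 2).toNNReal 2
  have hD0 : ∫ y, D y ∂γ = 0 := by
    simp only [hD]
    rw [integral_sub i1 (integrable_const _), sgE_int_one σ _ hσ]; simp
  have hD2 : ∫ y, D y ^ 2 ∂γ = Real.exp ((h {n}) ^ 2 / σ ^ 2) - 1 := by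
    have e : ∀ y, D y ^ 2 = sgE σ (h {n}) y ^ 2 - (2 * D y + 1) := fun y => by
      simp only [hD]; ring
    have iD : Integrable D γ := i1.sub (integrable_const 1)
    have iD' : Integrable (fun y => 2 * D y + 1) γ := (iD.const_mul 2).add (integrable_const 1)
    simp_rw [e]
    rw [integral_sub i2 iD', integral_add (iD.const_mul 2) (integrable_const 1),
      integral_const_mul, hD0, sgE_int_two σ _ hσ]
    simp
  have hM0 : 0 ≤ ∫ y, K y ^ 3 ∂γ := integral_nonneg fun y => by
    simp only [hK, Pi.zero_apply]; positivity
  refine ⟨7 * (∫ y, K y ^ 3 ∂γ) + 9 * (∫ y, K y ^ 3 ∂γ) ^ 2 + 1, by positivity, 1 / 2,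
    by norm_num, ?_⟩
  rintro q ⟨hq, hq2⟩
  have hq1 : q ≤ 1 := by linarith
  set ρ : ℝ → ℝ := fun y => sgMix (n + 1) q (fun J => sgE σ (h J) y) with hρ
  set τ : ℝ → ℝ := fun y => sgMix n q (fun J => sgE σ (h J) y) with hτ
  have hP : subsampledP n σ q h = γ.withDensity fun y => ENNReal.ofReal (ρ y) :=
    sg_measure (n + 1) σ q h hσ hq hq1
  have hQ : subsampledQ n σ q h = γ.withDensity fun y => ENNReal.ofReal (τ y) :=
    sg_measure n σ q h hσ hq hq1
  have hρ0 : ∀ y, 0 ≤ ρ y := fun y => sgMix_nonneg _ _ _ hq hq1 (hpos y)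
  have hτ0 : ∀ y, 0 ≤ τ y := fun y => sgMix_nonneg _ _ _ hq hq1 (hpos y)
  have hτp : ∀ y, 0 < τ y := fun y => by
    refine lt_of_le_of_ne (hτ0 y) fun hh => ?_
    have := sgMix_lower n q _ hq hq2 (hpos y) (he0 y)
    change 1 ≤ 2 ^ n * τ y at this
    rw [← hh] at this
    norm_num at this
  have hpt := fun y => sg_point n q (fun J => sgE σ (h J) y) hq hq2 (hpos y) (he0 y)
    (E y) (K y) rfl rfl
  set L : ℝ → ℝ := fun y => Real.log (ρ y / τ y) with hL
  have hLae : ∀ᵐ y ∂γ, privacyLoss n σ q h y = L y := by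
    have := sg_rnDeriv γ ρ τ (hMm _ _) (hMm _ _) hρ0 hτp
    filter_upwards [this] with y hy
    rw [privacyLoss, hP, hQ, hy]
  have hLm : Measurable L := ((hMm (n + 1) q).div (hMm n q)).log
  have hDm : Measurable D := (hEm _).sub_const 1
  have key : ∀ ω : ℝ → ℝ, Measurable ω → (∀ y, 0 ≤ ω y) → (∀ y, |ω y - 1| ≤ q * K y) →
      |varAgainst (γ.withDensity fun y => ENNReal.ofReal (ω y)) (privacyLoss n σ q h) -
          q ^ 2 * (Real.exp ((h {n}) ^ 2 / σ ^ 2) - 1)| ≤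
        (7 * (∫ y, K y ^ 3 ∂γ) + 9 * (∫ y, K y ^ 3 ∂γ) ^ 2 + 1) * q ^ 3 := by
    intro ω hωm hω0 hω
    have b := sg_var_bound γ K D ω L q _ hq hq1 (fun y => (hpt y).2.2.2.1) hK3 hDm hωm hLm
      (fun y => (hpt y).2.2.1) hω (fun y => (hpt y).2.2.2.2) hD0 hD2
    rw [varAgainst, sg_integral_density γ ω _ hωm hω0, sg_integral_density γ ω _ hωm hω0]
    have e1 : ∫ y, ω y * privacyLoss n σ q h y ^ 2 ∂γ = ∫ y, ω y * L y ^ 2 ∂γ :=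
      integral_congr_ae (by filter_upwards [hLae] with y hy; rw [hy])
    have e2 : ∫ y, ω y * privacyLoss n σ q h y ∂γ = ∫ y, ω y * L y ∂γ :=
      integral_congr_ae (by filter_upwards [hLae] with y hy; rw [hy])
    rw [e1, e2]
    refine b.trans ?_
    exact mul_le_mul_of_nonneg_right (by linarith) (by positivity)
  rw [hP, hQ]
  exact ⟨key ρ (hMm _ _) hρ0 fun y => (hpt y).2.1, key τ (hMm _ _) hτ0 fun y => (hpt y).1⟩
end
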